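/- arXiv:1509.06073 — 4 statements merged into one kernel-verified Lean document; each statement's English description precedes it below -/
import Mathlib

section
/- Let Δ ⊆ I be finite with |Δ| ≥ 1, let 0 < ε < 1 and δ > 0, and suppose m ≥ |Δ|_u · log(2|Δ|/ε) · (2δ^{-2} + 2δ^{-1}/3). Then, with probability at least 1 − ε over the i.i.d. draw of t_1,…,t_m from μ, the random matrix A = U/√m satisfies ‖P_Δ A* A P_Δ − P_Δ‖ ≤ δ, where ‖·‖ denotes the operator 2-norm on ℂ^Δ. -/
open scoped BigOperators
open MeasureTheory

/-- The (random) sampling matrix `U`, with entries `U_{kj} = √(ρ(t_k)) φ_j(t_k)`. -/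
noncomputable def Umat {D : Type*} {I : Type*} (ρ : D → ℝ) (φ : I → D → ℂ) {m : ℕ}
    (t : Fin m → D) (k : Fin m) (j : I) : ℂ :=
  (Real.sqrt (ρ (t k)) : ℂ) * φ j (t k)

/-- The normalized matrix `A = U/√m`. -/
noncomputable def Amat {D : Type*} {I : Type*} (ρ : D → ℝ) (φ : I → D → ℂ) {m : ℕ}
    (t : Fin m → D) (k : Fin m) (j : I) : ℂ :=
  Umat ρ φ t k j / (Real.sqrt m : ℂ)

/-- Application of `A` to a coefficient sequence `z : I → ℂ`. -/
noncomputable def Aapp {D : Type*} {I : Type*} (ρ : D → ℝ) (φ : I → D → ℂ) {m : ℕ}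
    (t : Fin m → D) (z : I → ℂ) (k : Fin m) : ℂ :=
  ∑' j, z j * Amat ρ φ t k j

/-- Application of `A* A` to a coefficient sequence `z : I → ℂ`. -/
noncomputable def AstarA {D : Type*} {I : Type*} (ρ : D → ℝ) (φ : I → D → ℂ) {m : ℕ}
    (t : Fin m → D) (z : I → ℂ) (i : I) : ℂ :=
  ∑ k, (starRingEnd ℂ) (Amat ρ φ t k i) * Aapp ρ φ t z k

/-- The ℓ² norm on `ℂ^m`. -/
noncomputable def l2m {m : ℕ} (y : Fin m → ℂ) : ℝ := Real.sqrt (∑ k, ‖y k‖ ^ 2)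

/-- The ℓ² norm on sequences indexed by `I`. -/
noncomputable def l2I {I : Type*} (z : I → ℂ) : ℝ := Real.sqrt (∑' i, ‖z i‖ ^ 2)

/-- The coordinate projection `P_S` onto a finite index set `S`. -/
def proj {I : Type*} [DecidableEq I] (S : Finset I) (z : I → ℂ) : I → ℂ :=
  fun i => if i ∈ S then z i else 0

section
open Matrix
variable {n : Type*} [Fintype n]

lemma Matrix.re_trace_mul_comm (A B : Matrix n n ℂ) :
    (A * B).trace.re = (B * A).trace.re := by
  rw [Matrix.trace_mul_comm]

lemma Matrix.re_trace_conjTranspose_mul_self_nonneg (A : Matrix n n ℂ) :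
    0 ≤ (Aᴴ * A).trace.re := by
  simp only [Matrix.trace, Matrix.diag, Matrix.mul_apply, Complex.re_sum]
  refine Finset.sum_nonneg fun i _ => Finset.sum_nonneg fun j _ => ?_
  simp [Matrix.conjTranspose_apply, Complex.mul_re]
  nlinarith [mul_self_nonneg (A j i).re, mul_self_nonneg (A j i).im]

lemma Matrix.re_trace_conjTranspose (A : Matrix n n ℂ) : Aᴴ.trace.re = A.trace.re := by
  simp [Matrix.trace_conjTranspose]

lemma Matrix.re_trace_sq_le (Z : Matrix n n ℂ) : (Z * Z).trace.re ≤ (Zᴴ * Z).trace.re := by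
  have h := Matrix.re_trace_conjTranspose_mul_self_nonneg (Z - Zᴴ)
  have e : (Z - Zᴴ)ᴴ * (Z - Zᴴ) = Zᴴ * Z - (Z * Z)ᴴ - Z * Z + Z * Zᴴ := by
    simp only [conjTranspose_sub, conjTranspose_conjTranspose, conjTranspose_mul]
    noncomm_ring
  rw [e] at h
  simp only [trace_add, trace_sub, Complex.add_re, Complex.sub_re,
    Matrix.re_trace_conjTranspose] at h
  rw [Matrix.re_trace_mul_comm Z Zᴴ] at h
  linarith

lemma Matrix.IsHermitian.re_trace_mul_le {A B : Matrix n n ℂ} (hA : A.IsHermitian)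
    (hB : B.IsHermitian) :
    (A * B).trace.re ≤ ((A * A).trace.re + (B * B).trace.re) / 2 := by
  have h := Matrix.re_trace_conjTranspose_mul_self_nonneg (A - B)
  have e : (A - B)ᴴ * (A - B) = A * A - A * B - B * A + B * B := by
    rw [conjTranspose_sub, hA.eq, hB.eq]
    noncomm_ring
  rw [e] at h
  simp only [trace_add, trace_sub, Complex.add_re, Complex.sub_re] at h
  rw [Matrix.re_trace_mul_comm B A] at h
  linarith

variable [DecidableEq n]

lemma Matrix.re_trace_mul_pow_comm (A B : Matrix n n ℂ) (k : ℕ) :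
    ((A * B) ^ k).trace.re = ((B * A) ^ k).trace.re := by
  cases k with
  | zero => simp
  | succ k =>
    rw [pow_succ, ← mul_assoc, Matrix.re_trace_mul_comm, ← mul_assoc, ← mul_pow_mul, mul_assoc,
      ← pow_succ]

/-- Dyadic trace inequalities underlying the Golden–Thompson inequality. -/
lemma Matrix.re_trace_pow_two_pow_aux (j : ℕ) :
    (∀ P Q : Matrix n n ℂ, P.IsHermitian → Q.IsHermitian →
      ((P * Q) ^ 2 ^ j).trace.re ≤ (P ^ 2 ^ j * Q ^ 2 ^ j).trace.re) ∧
    (∀ Z : Matrix n n ℂ, (Z ^ 2 ^ (j + 1)).trace.re ≤ ((Zᴴ * Z) ^ 2 ^ j).trace.re) := by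
  induction j with
  | zero => exact ⟨fun P Q _ _ => by simp, fun Z => by simpa [sq] using re_trace_sq_le Z⟩
  | succ j ih =>
    obtain ⟨hT, hS⟩ := ih
    refine ⟨fun P Q hP hQ => ?_, fun Z => ?_⟩
    · calc ((P * Q) ^ 2 ^ (j + 1)).trace.re
          ≤ (((P * Q)ᴴ * (P * Q)) ^ 2 ^ j).trace.re := hS _
        _ = (((P ^ 2) * (Q ^ 2)) ^ 2 ^ j).trace.re := by
          rw [conjTranspose_mul, hP.eq, hQ.eq, mul_assoc, Matrix.re_trace_mul_pow_comm]
          congr 3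
          noncomm_ring
        _ ≤ _ := hT _ _ (hP.pow 2) (hQ.pow 2)
        _ = _ := by rw [← pow_mul, ← pow_mul, pow_succ' 2 j]
    · have hX : (Zᴴ * Z).IsHermitian := isHermitian_conjTranspose_mul_self Z
      have hY : (Z * Zᴴ).IsHermitian := isHermitian_mul_conjTranspose_self Z
      calc (Z ^ 2 ^ (j + 1 + 1)).trace.re = ((Z ^ 2) ^ 2 ^ (j + 1)).trace.re := by
            rw [← pow_mul, pow_succ' 2 (j + 1)]
        _ ≤ _ := hS _
        _ = ((Zᴴ * Z * (Z * Zᴴ)) ^ 2 ^ j).trace.re := by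
          rw [show (Z ^ 2)ᴴ * Z ^ 2 = Zᴴ * (Zᴴ * Z * Z) by
            rw [conjTranspose_pow]; noncomm_ring, Matrix.re_trace_mul_pow_comm]
          congr 3
          noncomm_ring
        _ ≤ _ := hT _ _ hX hY
        _ ≤ _ := (hX.pow _).re_trace_mul_le (hY.pow _)
        _ = _ := by
          rw [← pow_add, ← pow_add, Matrix.re_trace_mul_pow_comm Z Zᴴ, ← two_mul,
            ← two_mul, ← pow_succ']
          ring
end

section
open Filter Topology

lemma norm_pow_sub_pow_le_of_norm_le {𝔸 : Type*} [NormedRing 𝔸] [NormOneClass 𝔸] {x y : 𝔸} {M : ℝ}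
    (hM : 1 ≤ M) (hx : ‖x‖ ≤ M) (hy : ‖y‖ ≤ M) (k : ℕ) :
    ‖x ^ k - y ^ k‖ ≤ k * M ^ k * ‖x - y‖ := by
  induction k with
  | zero => simp
  | succ k ih =>
    have e : x ^ (k + 1) - y ^ (k + 1) = x * (x ^ k - y ^ k) + (x - y) * y ^ k := by
      rw [pow_succ', pow_succ']; noncomm_ring
    have h1 : ‖y ^ k‖ ≤ M ^ (k + 1) :=
      (norm_pow_le y k).trans <| (pow_le_pow_left₀ (norm_nonneg _) hy k).trans
        (pow_le_pow_right₀ hM k.le_succ)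
    calc ‖x ^ (k + 1) - y ^ (k + 1)‖
        ≤ ‖x‖ * ‖x ^ k - y ^ k‖ + ‖x - y‖ * ‖y ^ k‖ := by
          rw [e]
          exact (norm_add_le _ _).trans (add_le_add (norm_mul_le _ _) (norm_mul_le _ _))
      _ ≤ M * (k * M ^ k * ‖x - y‖) + ‖x - y‖ * M ^ (k + 1) := by gcongr
      _ = _ := by push_cast; ring

lemma NormedSpace.norm_exp_le_exp_norm (𝕂 : Type*) {𝔸 : Type*} [RCLike 𝕂] [NormedRing 𝔸]
    [NormedAlgebra 𝕂 𝔸] [NormOneClass 𝔸] [CompleteSpace 𝔸] (x : 𝔸) :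
    ‖NormedSpace.exp x‖ ≤ Real.exp ‖x‖ := by
  have h := NormedSpace.exp_series_hasSum_exp' (𝕂 := 𝕂) x
  have h2 := NormedSpace.exp_series_hasSum_exp' (𝕂 := ℝ) ‖x‖
  rw [← Real.exp_eq_exp_ℝ] at h2
  refine h.norm_le_of_bounded h2 fun n => ?_
  rw [norm_smul]
  simp only [norm_inv, RCLike.norm_natCast, smul_eq_mul]
  gcongr
  exact norm_pow_le _ _

/-- The Lie–Trotter product formula. -/
lemma NormedSpace.tendsto_exp_mul_exp_pow (𝕂 : Type*) {𝔸 : Type*} [RCLike 𝕂] [NormedRing 𝔸]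
    [NormedAlgebra 𝕂 𝔸] [NormOneClass 𝔸] [CompleteSpace 𝔸] (A B : 𝔸) :
    Tendsto (fun k : ℕ => (exp ((k : 𝕂)⁻¹ • A) * exp ((k : 𝕂)⁻¹ • B)) ^ k) atTop
      (𝓝 (exp (A + B))) := by
  let : NormedAlgebra ℚ 𝔸 := NormedAlgebra.restrictScalars ℚ 𝕂 𝔸
  set f : 𝕂 → 𝔸 := fun s => exp (s • A) * exp (s • B) - exp (s • (A + B)) with hf
  have hder : HasDerivAt f 0 0 := by
    have h := ((hasDerivAt_exp_smul_const A (0 : 𝕂)).mul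
      (hasDerivAt_exp_smul_const B (0 : 𝕂))).sub (hasDerivAt_exp_smul_const (A + B) (0 : 𝕂))
    simp only [zero_smul, exp_zero, one_mul, mul_one, sub_self] at h
    exact h
  have hf0 : f 0 = 0 := by simp [hf]
  have hslope := (hasDerivAt_iff_tendsto_slope_zero.1 hder).norm
  simp only [zero_add, hf0, sub_zero, norm_zero, norm_smul, norm_inv] at hslope
  have hk : Tendsto (fun k : ℕ => ((k : 𝕂))⁻¹) atTop (𝓝[≠] 0) := by
    refine tendsto_nhdsWithin_iff.2 ⟨tendsto_inv_atTop_nhds_zero_nat (𝕜 := 𝕂), ?_⟩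
    filter_upwards [eventually_gt_atTop 0] with k hk
    simpa using hk.ne'
  have hlim := (hslope.comp hk).const_mul (Real.exp (‖A‖ + ‖B‖))
  rw [mul_zero] at hlim
  rw [tendsto_iff_norm_sub_tendsto_zero]
  refine squeeze_zero' (Eventually.of_forall fun _ => norm_nonneg _) ?_ hlim
  filter_upwards [eventually_gt_atTop 0] with k hk
  have hk' : (0 : ℝ) < k := by exact_mod_cast hk
  have hkK : (k : 𝕂) ≠ 0 := by exact_mod_cast hk.ne'
  have hY : exp (A + B) = exp ((k : 𝕂)⁻¹ • (A + B)) ^ k := by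
    rw [← exp_nsmul, ← Nat.cast_smul_eq_nsmul 𝕂, smul_smul, mul_inv_cancel₀ hkK, one_smul]
  set M := Real.exp ((k : ℝ)⁻¹ * (‖A‖ + ‖B‖)) with hM
  have hX1 : ‖exp ((k : 𝕂)⁻¹ • A) * exp ((k : 𝕂)⁻¹ • B)‖ ≤ M := by
    refine (norm_mul_le _ _).trans ((mul_le_mul (norm_exp_le_exp_norm 𝕂 _)
      (norm_exp_le_exp_norm 𝕂 _) (norm_nonneg _) (Real.exp_nonneg _)).trans ?_)
    rw [← Real.exp_add, norm_smul, norm_smul, hM, mul_add]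
    simp
  have hY1 : ‖exp ((k : 𝕂)⁻¹ • (A + B))‖ ≤ M := by
    refine (norm_exp_le_exp_norm 𝕂 _).trans (Real.exp_le_exp.2 ?_)
    rw [norm_smul, norm_inv, RCLike.norm_natCast]
    gcongr
    exact norm_add_le _ _
  have hM1 : 1 ≤ M := Real.one_le_exp (by positivity)
  have hMk : M ^ k = Real.exp (‖A‖ + ‖B‖) := by
    rw [hM, ← Real.exp_nat_mul, ← mul_assoc, mul_inv_cancel₀ hk'.ne', one_mul]
  rw [hY]
  refine (norm_pow_sub_pow_le_of_norm_le hM1 hX1 hY1 k).trans (le_of_eq ?_)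
  simp only [hMk, Function.comp, hf, norm_inv, RCLike.norm_natCast, inv_inv]
  ring
end

section
open Matrix Filter Topology
open scoped Matrix.Norms.L2Operator
variable {n : Type*}

lemma Matrix.IsHermitian.ofReal_smul {A : Matrix n n ℂ} (hA : A.IsHermitian) (c : ℝ) :
    ((c : ℂ) • A).IsHermitian := by
  rw [Matrix.IsHermitian, conjTranspose_smul, hA.eq]
  simp

variable [Fintype n]

lemma Matrix.continuous_re_trace : Continuous fun A : Matrix n n ℂ => A.trace.re :=
  Complex.continuous_re.comp (continuous_id.matrix_trace)

variable [DecidableEq n]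

lemma Matrix.continuous_exp : Continuous (NormedSpace.exp : Matrix n n ℂ → Matrix n n ℂ) := by
  let : NormedAlgebra ℚ (Matrix n n ℂ) := NormedAlgebra.restrictScalars ℚ ℂ _
  exact NormedSpace.exp_continuous

/-- The Golden–Thompson inequality. -/
lemma Matrix.IsHermitian.re_trace_exp_add_le {A B : Matrix n n ℂ} (hA : A.IsHermitian)
    (hB : B.IsHermitian) :
    (NormedSpace.exp (A + B)).trace.re ≤ (NormedSpace.exp A * NormedSpace.exp B).trace.re := by
  cases isEmpty_or_nonempty n
  · simp [Matrix.trace]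
  have hsub : Tendsto (fun j : ℕ => 2 ^ j) atTop atTop :=
    tendsto_pow_atTop_atTop_of_one_lt (one_lt_two : 1 < (2 : ℕ))
  have h := (Matrix.continuous_re_trace.tendsto _).comp
    ((NormedSpace.tendsto_exp_mul_exp_pow ℂ A B).comp hsub)
  refine le_of_tendsto h (Eventually.of_forall fun j => ?_)
  have key : ∀ C : Matrix n n ℂ,
      NormedSpace.exp ((((2 ^ j : ℕ) : ℂ))⁻¹ • C) ^ 2 ^ j = NormedSpace.exp C := fun C => by
    rw [← Matrix.exp_nsmul, ← Nat.cast_smul_eq_nsmul ℂ, smul_smul, mul_inv_cancel₀ (by simp),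
      one_smul]
  have hherm : ∀ C : Matrix n n ℂ, C.IsHermitian →
      (NormedSpace.exp ((((2 ^ j : ℕ) : ℂ))⁻¹ • C)).IsHermitian := fun C hC => by
    have := (hC.ofReal_smul (((2 ^ j : ℕ) : ℝ))⁻¹).exp
    rwa [Complex.ofReal_inv, Complex.ofReal_natCast] at this
  have := (Matrix.re_trace_pow_two_pow_aux j).1 _ _ (hherm A hA) (hherm B hB)
  rwa [key, key] at this

lemma Matrix.IsHermitian.exists_exp_eq_mul_self {H : Matrix n n ℂ} (hH : H.IsHermitian) :
    ∃ P : Matrix n n ℂ, P.IsHermitian ∧ NormedSpace.exp H = P * P := by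
  refine ⟨NormedSpace.exp (((1 / 2 : ℝ) : ℂ) • H), (hH.ofReal_smul _).exp, ?_⟩
  rw [← Matrix.exp_add_of_commute _ _ (Commute.refl _), ← add_smul]
  norm_num

lemma Matrix.IsHermitian.re_trace_exp_nonneg {H : Matrix n n ℂ} (hH : H.IsHermitian) :
    0 ≤ (NormedSpace.exp H).trace.re := by
  obtain ⟨P, hP, e⟩ := hH.exists_exp_eq_mul_self
  have := Matrix.re_trace_conjTranspose_mul_self_nonneg P
  rwa [hP.eq, ← e] at this

lemma Matrix.IsHermitian.diagonalization {Y : Matrix n n ℂ} (hY : Y.IsHermitian) :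
    Y = (hY.eigenvectorUnitary : Matrix n n ℂ) *
      diagonal (fun i => (hY.eigenvalues i : ℂ)) *
        star (hY.eigenvectorUnitary : Matrix n n ℂ) := by
  have := hY.spectral_theorem
  rw [Unitary.conjStarAlgAut_apply] at this
  exact this

lemma Matrix.IsHermitian.exp_eigenvalue_le {Y : Matrix n n ℂ} (hY : Y.IsHermitian) (θ : ℝ)
    (i : n) : Real.exp (θ * hY.eigenvalues i) ≤ (NormedSpace.exp ((θ : ℂ) • Y)).trace.re := by
  set U := hY.eigenvectorUnitary with hU
  have hinv : (U : Matrix n n ℂ)⁻¹ = star (U : Matrix n n ℂ) :=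
    Matrix.inv_eq_left_inv (Unitary.coe_star_mul_self U)
  have hunit : IsUnit (U : Matrix n n ℂ) := (Unitary.toUnits U).isUnit
  have e : (θ : ℂ) • Y = (U : Matrix n n ℂ) *
      diagonal (fun i => ((θ * hY.eigenvalues i : ℝ) : ℂ)) * (U : Matrix n n ℂ)⁻¹ := by
    conv_lhs => rw [hY.diagonalization]
    rw [hinv, ← Matrix.smul_mul, ← Matrix.mul_smul, ← diagonal_smul]
    congr 3
    ext i
    simp
  rw [e, Matrix.exp_conj _ _ hunit, Matrix.trace_mul_comm, ← mul_assoc,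
    Matrix.nonsing_inv_mul _ ((Matrix.isUnit_iff_isUnit_det _).1 hunit), one_mul,
    Matrix.exp_diagonal, Matrix.trace_diagonal, Complex.re_sum]
  have e2 : ∀ j, (NormedSpace.exp (fun i => ((θ * hY.eigenvalues i : ℝ) : ℂ)) j).re =
      Real.exp (θ * hY.eigenvalues j) := fun j => by
    rw [Pi.coe_exp, ← Complex.exp_eq_exp_ℂ, ← Complex.ofReal_exp, Complex.ofReal_re]
  simp only [e2]
  exact Finset.single_le_sum (f := fun j => Real.exp (θ * hY.eigenvalues j))
    (fun j _ => (Real.exp_pos _).le) (Finset.mem_univ i)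

lemma Matrix.IsHermitian.l2_opNorm_sub_le {Y : Matrix n n ℂ} (hY : Y.IsHermitian) {c r : ℝ}
    (hr : 0 ≤ r) (h : ∀ i, |hY.eigenvalues i - c| ≤ r) : ‖Y - (c : ℂ) • 1‖ ≤ r := by
  set U := hY.eigenvectorUnitary with hU
  have e : Y - (c : ℂ) • 1 = (U : Matrix n n ℂ) *
      diagonal (fun i => ((hY.eigenvalues i - c : ℝ) : ℂ)) * (star U : unitary (Matrix n n ℂ)) := by
    have hd : diagonal (fun i => ((hY.eigenvalues i - c : ℝ) : ℂ)) =
        diagonal (fun i => (hY.eigenvalues i : ℂ)) - (c : ℂ) • (1 : Matrix n n ℂ) := by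
      rw [Matrix.smul_one_eq_diagonal, diagonal_sub]
      simp
    rw [hd, mul_sub, sub_mul, Unitary.coe_star, ← hY.diagonalization]
    simp
  rw [e, CStarRing.norm_mul_coe_unitary, CStarRing.norm_coe_unitary_mul, l2_opNorm_diagonal]
  refine (pi_norm_le_iff_of_nonneg hr).2 fun i => ?_
  rw [Complex.norm_real]
  exact h i

lemma NormedSpace.exp_smul_of_mul_self {W : Matrix n n ℂ} {r : ℝ} (hr : r ≠ 0)
    (hW : W * W = (r : ℂ) • W) (θ : ℝ) :
    exp ((θ : ℂ) • W) = 1 + (((Real.exp (θ * r) - 1) / r : ℝ) : ℂ) • W := by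
  have hp : ∀ k : ℕ, W ^ (k + 1) = ((r : ℂ) ^ k) • W := fun k => by
    induction k with
    | zero => simp
    | succ k ih => rw [pow_succ, ih, smul_mul_assoc, hW, smul_smul, pow_succ]
  have hrC : (r : ℂ) ≠ 0 := by exact_mod_cast hr
  have h1 := NormedSpace.exp_series_hasSum_exp' (𝕂 := ℂ) ((θ : ℂ) • W)
  have h2 := NormedSpace.exp_series_hasSum_exp' (𝕂 := ℂ) ((θ * r : ℝ) : ℂ)
  rw [← Complex.exp_eq_exp_ℂ, ← Complex.ofReal_exp] at h2
  rw [← hasSum_nat_add_iff' 1] at h1 h2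
  have h3 := (h2.mul_left ((r : ℂ)⁻¹)).smul_const W
  simp only [Finset.range_one, Finset.sum_singleton, Nat.factorial_zero, Nat.cast_one, inv_one,
    pow_zero, one_smul] at h1 h3
  have hterm : ∀ k : ℕ, (((k + 1).factorial : ℂ))⁻¹ • ((θ : ℂ) • W) ^ (k + 1) =
      ((r : ℂ)⁻¹ * ((((k + 1).factorial : ℂ))⁻¹ • ((θ * r : ℝ) : ℂ) ^ (k + 1))) • W := fun k => by
    rw [smul_pow, hp, smul_smul, smul_smul]
    congr 1
    push_cast
    rw [smul_eq_mul, mul_pow, pow_succ (r : ℂ)]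
    field_simp
  simp only [hterm] at h1
  have e := h1.unique h3
  rw [sub_eq_iff_eq_add'] at e
  rw [e]
  congr 2
  push_cast
  field_simp
end

section
open Matrix
variable {n : Type*}

/-- The rank-one matrix `w* w` associated with a row vector `w`. -/
noncomputable def rankOne (w : n → ℂ) : Matrix n n ℂ := vecMulVec (star w) w

lemma rankOne_isHermitian (w : n → ℂ) : (rankOne w).IsHermitian := by
  ext i j
  simp [rankOne, vecMulVec_apply, mul_comm]

variable [Fintype n]

lemma rankOne_mul_self (w : n → ℂ) :
    rankOne w * rankOne w = ((∑ i, ‖w i‖ ^ 2 : ℝ) : ℂ) • rankOne w := by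
  ext i j
  simp only [rankOne, Matrix.mul_apply, vecMulVec_apply, Matrix.smul_apply, Pi.star_apply,
    smul_eq_mul, Complex.ofReal_sum, Finset.sum_mul]
  refine Finset.sum_congr rfl fun k _ => ?_
  have : ((‖w k‖ ^ 2 : ℝ) : ℂ) = w k * star (w k) := by
    rw [Complex.star_def, Complex.mul_conj, Complex.normSq_eq_norm_sq]
  rw [this]
  ring

lemma rankOne_eq_zero {w : n → ℂ} (h : ∑ i, ‖w i‖ ^ 2 = 0) : rankOne w = 0 := by
  have : ∀ i, w i = 0 := fun i => by
    have := (Finset.sum_eq_zero_iff_of_nonneg (fun i _ => by positivity)).1 h i (Finset.mem_univ i)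
    simpa using this
  ext i j
  simp [rankOne, vecMulVec_apply, this]

variable [DecidableEq n]

lemma Real.exp_mul_sub_one_div_le (θ : ℝ) {r K : ℝ} (hr : 0 < r) (hrK : r ≤ K) :
    (Real.exp (θ * r) - 1) / r ≤ (Real.exp (θ * K) - 1) / K := by
  have hK := hr.trans_le hrK
  have h := convexOn_exp.2 (Set.mem_univ (θ * K)) (Set.mem_univ 0)
    (div_nonneg hr.le hK.le) (sub_nonneg.2 ((div_le_one hK).2 hrK)) (add_sub_cancel _ _)
  simp only [smul_eq_mul, mul_zero, add_zero, Real.exp_zero, mul_one] at h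
  rw [show r / K * (θ * K) = θ * r by field_simp] at h
  rw [div_le_iff₀ hr]
  calc Real.exp (θ * r) - 1 ≤ r / K * Real.exp (θ * K) + (1 - r / K) - 1 := by linarith
    _ = _ := by field_simp; ring

lemma Matrix.IsHermitian.re_trace_exp_mul_rankOne_nonneg {H : Matrix n n ℂ} (hH : H.IsHermitian)
    (w : n → ℂ) : 0 ≤ (NormedSpace.exp H * rankOne w).trace.re := by
  obtain ⟨P, hP, e⟩ := hH.exists_exp_eq_mul_self
  rcases (Finset.sum_nonneg fun i _ => sq_nonneg ‖w i‖ :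
    0 ≤ ∑ i, ‖w i‖ ^ 2).eq_or_lt with h0 | h0
  · simp [rankOne_eq_zero h0.symm]
  · have h := Matrix.re_trace_conjTranspose_mul_self_nonneg (P * rankOne w)
    rw [conjTranspose_mul, hP.eq, (rankOne_isHermitian w).eq, mul_assoc, ← mul_assoc P, ← e,
      Matrix.trace_mul_comm, mul_assoc, rankOne_mul_self, Matrix.mul_smul, Matrix.trace_smul,
      smul_eq_mul, Complex.re_ofReal_mul] at h
    exact nonneg_of_mul_nonneg_right h h0

lemma Matrix.IsHermitian.re_trace_exp_add_smul_rankOne_le {H : Matrix n n ℂ} (hH : H.IsHermitian)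
    {w : n → ℂ} {K : ℝ} (hw : ∑ i, ‖w i‖ ^ 2 ≤ K) (θ : ℝ) :
    (NormedSpace.exp (H + (θ : ℂ) • rankOne w)).trace.re ≤ (NormedSpace.exp H).trace.re +
      (Real.exp (θ * K) - 1) / K * (NormedSpace.exp H * rankOne w).trace.re := by
  rcases (Finset.sum_nonneg fun i _ => sq_nonneg ‖w i‖ :
    0 ≤ ∑ i, ‖w i‖ ^ 2).eq_or_lt with h0 | h0
  · simp [rankOne_eq_zero h0.symm]
  · refine (hH.re_trace_exp_add_le ((rankOne_isHermitian w).ofReal_smul θ)).trans ?_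
    rw [NormedSpace.exp_smul_of_mul_self h0.ne' (rankOne_mul_self w), mul_add, mul_one,
      Matrix.mul_smul, Matrix.trace_add, Complex.add_re, Matrix.trace_smul, smul_eq_mul,
      Complex.re_ofReal_mul]
    exact add_le_add_right (mul_le_mul_of_nonneg_right (Real.exp_mul_sub_one_div_le θ h0 hw)
      (hH.re_trace_exp_mul_rankOne_nonneg w)) _

open MeasureTheory
variable {D : Type*} [MeasurableSpace D]

lemma measurable_re_trace_exp {X : Type*} [MeasurableSpace X] {F : X → Matrix n n ℂ}
    (hF : ∀ i j, Measurable fun x => F x i j) :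
    Measurable fun x => (NormedSpace.exp (F x)).trace.re := by
  have h : Measurable (fun x => (fun i j => F x i j : n → n → ℂ)) :=
    measurable_pi_lambda _ fun i => measurable_pi_lambda _ fun j => hF i j
  have hc : Continuous fun A : n → n → ℂ => (NormedSpace.exp (Matrix.of A)).trace.re :=
    Matrix.continuous_re_trace.comp (Matrix.continuous_exp.comp continuous_id)
  exact hc.measurable.comp h

lemma integral_re_trace_mul_rankOne {μ : Measure D} {w : D → n → ℂ}
    (hint : ∀ i j, Integrable (fun s => star (w s i) * w s j) μ)
    (horth : ∀ i j, ∫ s, star (w s i) * w s j ∂μ = if i = j then 1 else 0)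
    (E : Matrix n n ℂ) :
    Integrable (fun s => (E * rankOne (w s)).trace.re) μ ∧
      ∫ s, (E * rankOne (w s)).trace.re ∂μ = E.trace.re := by
  have e : (fun s => (E * rankOne (w s)).trace) =
      fun s => ∑ i, ∑ j, E i j * (star (w s j) * w s i) := by
    ext s
    simp [Matrix.trace, Matrix.mul_apply, rankOne, vecMulVec_apply]
  have hi : ∀ i j, Integrable (fun s => E i j * (star (w s j) * w s i)) μ :=
    fun i j => (hint j i).const_mul _
  have hI : Integrable (fun s => (E * rankOne (w s)).trace) μ := by
    rw [e]
    exact integrable_finsetSum _ fun i _ => integrable_finsetSum _ fun j _ => hi i j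
  refine ⟨hI.re, ?_⟩
  have h2 : ∫ s, (E * rankOne (w s)).trace ∂μ = E.trace := by
    rw [e, integral_finsetSum _ fun i _ => integrable_finsetSum _ fun j _ => hi i j]
    simp only [integral_finsetSum _ fun j _ => hi _ j, integral_const_mul, horth]
    simp [Matrix.trace]
  rw [← h2]
  exact integral_re hI

variable {μ : Measure D} [IsProbabilityMeasure μ] {w : D → n → ℂ} {K : ℝ}

lemma lintegral_re_trace_exp_add_le
    (hint : ∀ i j, Integrable (fun s => star (w s i) * w s j) μ)
    (horth : ∀ i j, ∫ s, star (w s i) * w s j ∂μ = if i = j then 1 else 0)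
    (hw : ∀ s, ∑ i, ‖w s i‖ ^ 2 ≤ K) (θ : ℝ) {H : Matrix n n ℂ} (hH : H.IsHermitian) :
    ∫⁻ s, ENNReal.ofReal (NormedSpace.exp (H + (θ : ℂ) • rankOne (w s))).trace.re ∂μ ≤
      ENNReal.ofReal ((1 + (Real.exp (θ * K) - 1) / K) * (NormedSpace.exp H).trace.re) := by
  have hle := fun s => hH.re_trace_exp_add_smul_rankOne_le (hw s) θ
  obtain ⟨hI, hE⟩ := integral_re_trace_mul_rankOne hint horth (NormedSpace.exp H)
  refine (lintegral_mono fun s => ENNReal.ofReal_le_ofReal (hle s)).trans ?_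
  rw [← ofReal_integral_eq_lintegral_ofReal
      (f := fun s => (NormedSpace.exp H).trace.re + (Real.exp (θ * K) - 1) / K *
        (NormedSpace.exp H * rankOne (w s)).trace.re) ((integrable_const _).add (hI.const_mul _))
    (Filter.Eventually.of_forall fun s => le_trans
      (hH.add ((rankOne_isHermitian _).ofReal_smul θ)).re_trace_exp_nonneg (hle s)),
    integral_add (integrable_const _) (hI.const_mul _), integral_const_mul, hE]
  refine ENNReal.ofReal_le_ofReal (le_of_eq ?_)
  simp
  ring

lemma lintegral_re_trace_exp_sum_le (hwm : ∀ i, Measurable fun s => w s i)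
    (hint : ∀ i j, Integrable (fun s => star (w s i) * w s j) μ)
    (horth : ∀ i j, ∫ s, star (w s i) * w s j ∂μ = if i = j then 1 else 0)
    (hw : ∀ s, ∑ i, ‖w s i‖ ^ 2 ≤ K) (θ : ℝ) (hθ : 0 ≤ 1 + (Real.exp (θ * K) - 1) / K)
    (m : ℕ) {H : Matrix n n ℂ} (hH : H.IsHermitian) :
    ∫⁻ t : Fin m → D, ENNReal.ofReal
        (NormedSpace.exp (H + (θ : ℂ) • ∑ k, rankOne (w (t k)))).trace.re
          ∂(Measure.pi fun _ => μ) ≤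
      ENNReal.ofReal ((1 + (Real.exp (θ * K) - 1) / K) ^ m * (NormedSpace.exp H).trace.re) := by
  induction m generalizing H with
  | zero => simp
  | succ m ih =>
    have hmp := (measurePreserving_piFinSuccAbove (fun _ : Fin (m + 1) => μ) 0).symm
    rw [← hmp.lintegral_comp_emb (MeasurableEquiv.measurableEmbedding _)]
    have hmeas : Measurable fun p : D × (Fin m → D) => ENNReal.ofReal
        (NormedSpace.exp (H + (θ : ℂ) • rankOne (w p.1) +
          (θ : ℂ) • ∑ k, rankOne (w (p.2 k)))).trace.re := by
      refine (measurable_re_trace_exp fun i j => ?_).ennreal_ofReal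
      simp only [Matrix.add_apply, Matrix.smul_apply, Matrix.sum_apply, rankOne, vecMulVec_apply,
        Pi.star_apply, smul_eq_mul]
      have h1 : ∀ i, Measurable fun p : D × (Fin m → D) => w p.1 i :=
        fun i => (hwm i).comp measurable_fst
      have h2 : ∀ k i, Measurable fun p : D × (Fin m → D) => w (p.2 k) i :=
        fun k i => (hwm i).comp ((measurable_pi_apply k).comp measurable_snd)
      have hstar : Measurable (star : ℂ → ℂ) := continuous_star.measurable
      exact (measurable_const.add (((hstar.comp (h1 i)).mul (h1 j)).const_mul _)).add
        ((Finset.measurable_sum _ fun k _ => (hstar.comp (h2 k i)).mul (h2 k j)).const_mul _)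
    have e : ∀ p : D × (Fin m → D), ENNReal.ofReal (NormedSpace.exp (H + (θ : ℂ) • ∑ k, rankOne
        (w ((MeasurableEquiv.piFinSuccAbove (fun _ : Fin (m + 1) => D) 0).symm p k)))).trace.re =
        ENNReal.ofReal (NormedSpace.exp (H + (θ : ℂ) • rankOne (w p.1) +
          (θ : ℂ) • ∑ k, rankOne (w (p.2 k)))).trace.re := fun p => by
      rw [Fin.sum_univ_succ, smul_add, ← add_assoc]
      rfl
    simp only [e]
    rw [lintegral_prod _ hmeas.aemeasurable]
    have hstep : ∀ s, ∫⁻ t : Fin m → D, ENNReal.ofReal (NormedSpace.exp (H +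
        (θ : ℂ) • rankOne (w s) + (θ : ℂ) • ∑ k, rankOne (w (t k)))).trace.re
          ∂(Measure.pi fun _ => μ) ≤
        ENNReal.ofReal ((1 + (Real.exp (θ * K) - 1) / K) ^ m) * ENNReal.ofReal
            (NormedSpace.exp (H + (θ : ℂ) • rankOne (w s))).trace.re := fun s => by
      rw [← ENNReal.ofReal_mul (pow_nonneg hθ m)]
      exact ih (hH.add ((rankOne_isHermitian _).ofReal_smul θ))
    refine (lintegral_mono hstep).trans ?_
    rw [lintegral_const_mul' _ _ ENNReal.ofReal_ne_top, pow_succ, mul_assoc,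
      ENNReal.ofReal_mul (pow_nonneg hθ m)]
    exact mul_le_mul' le_rfl (lintegral_re_trace_exp_add_le hint horth hw θ hH)
end

lemma Real.exp_sub_one_sub_id_le_of_lt_three {τ : ℝ} (h0 : 0 ≤ τ) (h3 : τ < 3) :
    Real.exp τ - 1 - τ ≤ τ ^ 2 / (2 * (1 - τ / 3)) := by
  have h := NormedSpace.exp_series_hasSum_exp' (𝕂 := ℝ) τ
  rw [← Real.exp_eq_exp_ℝ, ← hasSum_nat_add_iff' 2] at h
  have hg := (hasSum_geometric_of_lt_one (div_nonneg h0 (by norm_num : (0 : ℝ) ≤ 3))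
    ((div_lt_one (by norm_num)).2 h3)).mul_left (τ ^ 2 / 2)
  have hfac : ∀ k : ℕ, (2 : ℝ) * 3 ^ k ≤ ((k + 2).factorial : ℝ) := fun k => by
    induction k with
    | zero => simp
    | succ k ih =>
      rw [show k + 1 + 2 = (k + 2) + 1 by ring, Nat.factorial_succ, pow_succ]
      push_cast
      nlinarith [(Nat.cast_nonneg k : (0 : ℝ) ≤ k), (by positivity : (0 : ℝ) < 3 ^ k)]
  have hle := hasSum_le (fun k => ?_) h hg
  · simp [Finset.sum_range_succ] at hle
    calc Real.exp τ - 1 - τ ≤ τ ^ 2 / 2 * (1 - τ / 3)⁻¹ := by linarith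
      _ = _ := by rw [div_mul_eq_div_div, div_eq_mul_inv (τ ^ 2 / 2)]
  · calc ((k + 2).factorial : ℝ)⁻¹ • τ ^ (k + 2) ≤ ((2 : ℝ) * 3 ^ k)⁻¹ * τ ^ (k + 2) := by
          rw [smul_eq_mul]
          gcongr
          exact hfac k
      _ = _ := by rw [div_pow, pow_add]; field_simp

/-- The optimized exponent in Bernstein's inequality. -/
lemma Real.exp_bernstein_exponent_le {δ σ : ℝ} (hδ : 0 < δ) (hσ : σ = 1 ∨ σ = -1) :
    Real.exp (σ * (δ / (1 + δ / 3))) - 1 - σ * (δ / (1 + δ / 3)) - δ / (1 + δ / 3) * δ ≤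
      -(2 / δ ^ 2 + 2 / (3 * δ))⁻¹ := by
  set τ := δ / (1 + δ / 3) with hτ
  have hτ0 : 0 < τ := by positivity
  have hτ3 : τ < 3 := by
    rw [hτ, div_lt_iff₀ (by positivity)]
    linarith
  have h1 := Real.exp_sub_one_sub_id_le_of_lt_three hτ0.le hτ3
  have h2 : Real.exp (σ * τ) - 1 - σ * τ ≤ Real.exp τ - 1 - τ := by
    rcases hσ with rfl | rfl
    · simp
    · have := Real.self_le_sinh_iff.2 hτ0.le
      rw [Real.sinh_eq] at this
      rw [neg_one_mul]
      linarith
  have h3 : τ ^ 2 / (2 * (1 - τ / 3)) - τ * δ = -(2 / δ ^ 2 + 2 / (3 * δ))⁻¹ := by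
    have e : 1 - τ / 3 = (1 + δ / 3)⁻¹ := by
      rw [hτ]; field_simp; ring
    rw [e, hτ]
    field_simp
    ring
  linarith

section
open Matrix MeasureTheory
open scoped Matrix.Norms.L2Operator
variable {n : Type*} [Fintype n] [DecidableEq n] {D : Type*} [MeasurableSpace D]
  {μ : Measure D} [IsProbabilityMeasure μ] {w : D → n → ℂ} {K : ℝ}

lemma measure_exp_le_re_trace_exp_sum_le (hwm : ∀ i, Measurable fun s => w s i)
    (hint : ∀ i j, Integrable (fun s => star (w s i) * w s j) μ)
    (horth : ∀ i j, ∫ s, star (w s i) * w s j ∂μ = if i = j then 1 else 0)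
    (hK : 1 ≤ K) (hw : ∀ s, ∑ i, ‖w s i‖ ^ 2 ≤ K) (θ a : ℝ) (m : ℕ) :
    (Measure.pi fun _ : Fin m => μ) {t | Real.exp a ≤
        (NormedSpace.exp ((θ : ℂ) • ∑ k, rankOne (w (t k)))).trace.re} ≤
      ENNReal.ofReal (Fintype.card n * Real.exp (m * ((Real.exp (θ * K) - 1) / K) - a)) := by
  have hθ : 0 ≤ 1 + (Real.exp (θ * K) - 1) / K := by
    rw [← neg_le_iff_add_nonneg', le_div_iff₀ (by linarith)]
    linarith [Real.exp_pos (θ * K)]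
  have hmgf := lintegral_re_trace_exp_sum_le hwm hint horth hw θ hθ m
    (isHermitian_zero : (0 : Matrix n n ℂ).IsHermitian)
  simp only [zero_add, NormedSpace.exp_zero, trace_one, Complex.natCast_re] at hmgf
  have hmeas : Measurable fun t : Fin m → D => ENNReal.ofReal
      (NormedSpace.exp ((θ : ℂ) • ∑ k, rankOne (w (t k)))).trace.re := by
    refine (measurable_re_trace_exp fun i j => ?_).ennreal_ofReal
    simp only [Matrix.smul_apply, Matrix.sum_apply, rankOne, vecMulVec_apply,
      Pi.star_apply, smul_eq_mul]
    have hstar : Measurable (star : ℂ → ℂ) := continuous_star.measurable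
    have h2 : ∀ k i, Measurable fun t : Fin m → D => w (t k) i :=
      fun k i => (hwm i).comp (measurable_pi_apply k)
    exact (Finset.measurable_sum _ fun k _ => (hstar.comp (h2 k i)).mul (h2 k j)).const_mul _
  refine (measure_mono fun t ht => ?_).trans ((meas_ge_le_lintegral_div hmeas.aemeasurable
    (ENNReal.ofReal_pos.2 (Real.exp_pos a)).ne' ENNReal.ofReal_ne_top).trans
      ((ENNReal.div_le_div_right hmgf _).trans ?_))
  · exact ENNReal.ofReal_le_ofReal ht
  · rw [← ENNReal.ofReal_div_of_pos (Real.exp_pos a)]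
    refine ENNReal.ofReal_le_ofReal ?_
    rw [Real.exp_sub, mul_comm, mul_div_assoc, Real.exp_nat_mul]
    gcongr
    rw [add_comm]
    exact Real.add_one_le_exp _

/-- Matrix Bernstein inequality for sums of i.i.d. isotropic rank-one matrices. -/
lemma measure_rankOne_sum_bernstein [Nonempty n] (hwm : ∀ i, Measurable fun s => w s i)
    (hint : ∀ i j, Integrable (fun s => star (w s i) * w s j) μ)
    (horth : ∀ i j, ∫ s, star (w s i) * w s j ∂μ = if i = j then 1 else 0)
    (hK : 1 ≤ K) (hw : ∀ s, ∑ i, ‖w s i‖ ^ 2 ≤ K) {ε δ : ℝ} (hε : 0 < ε) (hδ : 0 < δ) {m : ℕ}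
    (hm : K * Real.log (2 * Fintype.card n / ε) * (2 / δ ^ 2 + 2 / (3 * δ)) ≤ m) :
    1 - ENNReal.ofReal ε ≤ (Measure.pi fun _ : Fin m => μ)
      {t | ‖(∑ k, rankOne (w (t k))) - (m : ℂ) • (1 : Matrix n n ℂ)‖ ≤ m * δ} := by
  have hK0 : 0 < K := by linarith
  have hN : (0 : ℝ) < Fintype.card n := by exact_mod_cast Fintype.card_pos
  set τ := δ / (1 + δ / 3) with hτ
  have hτ0 : 0 < τ := by positivity
  set B : ℝ → Set (Fin m → D) := fun σ => {t | Real.exp (σ * τ / K * (m * (1 + σ * δ))) ≤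
    (NormedSpace.exp (((σ * τ / K : ℝ) : ℂ) • ∑ k, rankOne (w (t k)))).trace.re} with hB
  have htail : ∀ σ : ℝ, σ = 1 ∨ σ = -1 →
      (Measure.pi fun _ : Fin m => μ) (B σ) ≤ ENNReal.ofReal (ε / 2) := fun σ hσ => by
    refine (measure_exp_le_re_trace_exp_sum_le hwm hint horth hK hw _ _ m).trans
      (ENNReal.ofReal_le_ofReal ?_)
    have hσ2 : σ * σ = 1 := by rcases hσ with rfl | rfl <;> norm_num
    have hc : 0 < 2 / δ ^ 2 + 2 / (3 * δ) := by positivity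
    have e : m * ((Real.exp (σ * τ / K * K) - 1) / K) - σ * τ / K * (m * (1 + σ * δ)) =
        m / K * (Real.exp (σ * τ) - 1 - σ * τ - τ * δ) := by
      rw [div_mul_cancel₀ _ hK0.ne']
      field_simp
      linear_combination (-τ * δ * m) * hσ2
    have hexp : m / K * (Real.exp (σ * τ) - 1 - σ * τ - τ * δ) ≤
        -Real.log (2 * Fintype.card n / ε) := by
      have h1 := mul_le_mul_of_nonneg_left (Real.exp_bernstein_exponent_le hδ hσ)
        (by positivity : 0 ≤ m / K)
      refine h1.trans ?_
      rw [mul_neg, neg_le_neg_iff, ← div_eq_mul_inv, le_div_iff₀ hc, le_div_iff₀ hK0]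
      linarith
    rw [e]
    calc _ ≤ Fintype.card n * Real.exp (-Real.log (2 * Fintype.card n / ε)) := by gcongr
      _ = ε / 2 := by
        rw [Real.exp_neg, Real.exp_log (by positivity)]
        field_simp
  have hcover : (Set.univ : Set (Fin m → D)) ⊆
      {t | ‖(∑ k, rankOne (w (t k))) - (m : ℂ) • (1 : Matrix n n ℂ)‖ ≤ m * δ} ∪
        (B 1 ∪ B (-1)) := fun t _ => by
    by_contra hcon
    simp only [Set.mem_union, not_or] at hcon
    obtain ⟨h1, h2, h3⟩ := hcon
    refine h1 ?_
    have hY : (∑ k, rankOne (w (t k))).IsHermitian := by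
      rw [Matrix.IsHermitian, conjTranspose_sum]
      exact Finset.sum_congr rfl fun k _ => (rankOne_isHermitian _).eq
    have := hY.l2_opNorm_sub_le (c := m) (r := m * δ) (by positivity) fun i => ?_
    · simpa using this
    have h2' := (hY.exp_eigenvalue_le (1 * τ / K) i).trans_lt (not_le.1 h2)
    have h3' := (hY.exp_eigenvalue_le (-1 * τ / K) i).trans_lt (not_le.1 h3)
    rw [Real.exp_lt_exp, ← sub_pos, ← mul_sub] at h2' h3'
    have hτK : 0 < τ / K := by positivity
    have h2'' : 0 < m * (1 + 1 * δ) - hY.eigenvalues i :=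
      (mul_pos_iff_of_pos_left hτK).1 (by rwa [one_mul] at h2')
    have h3'' : 0 < hY.eigenvalues i - m * (1 + -1 * δ) :=
      (mul_pos_iff_of_pos_left hτK).1 (lt_of_lt_of_eq h3' (by ring))
    rw [abs_le]
    constructor <;> linarith
  have hε2 : ENNReal.ofReal (ε / 2) + ENNReal.ofReal (ε / 2) = ENNReal.ofReal ε := by
    rw [← ENNReal.ofReal_add (by positivity) (by positivity), add_halves]
  rw [tsub_le_iff_right, ← hε2, ← measure_univ (μ := Measure.pi fun _ : Fin m => μ)]
  refine (measure_mono hcover).trans ((measure_union_le _ _).trans (add_le_add le_rfl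
    ((measure_union_le _ _).trans (add_le_add (htail 1 (Or.inl rfl)) (htail _ (Or.inr rfl))))))
end

section
open Matrix
open scoped Matrix.Norms.L2Operator

lemma Matrix.sqrt_sum_norm_sq_mulVec_le {n : Type*} [Fintype n] [DecidableEq n]
    (A : Matrix n n ℂ) (z : n → ℂ) :
    Real.sqrt (∑ i, ‖(A *ᵥ z) i‖ ^ 2) ≤ ‖A‖ * Real.sqrt (∑ i, ‖z i‖ ^ 2) := by
  have h := A.l2_opNorm_mulVec (WithLp.toLp 2 z)
  rwa [EuclideanSpace.norm_eq, EuclideanSpace.norm_eq] at h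

lemma l2I_eq_of_forall_notMem {I : Type*} {S : Finset I} {z : I → ℂ}
    (hz : ∀ i ∉ S, z i = 0) :
    l2I z = Real.sqrt (∑ i : {i // i ∈ S}, ‖z i‖ ^ 2) := by
  rw [l2I, tsum_eq_sum (s := S) (fun i hi => by simp [hz i hi]), ← Finset.sum_coe_sort]

/-- The rows of `U` restricted to the columns indexed by `S`, as functions of the sample point. -/
noncomputable def rowVec {D I : Type*} (ρ : D → ℝ) (φ : I → D → ℂ) (S : Finset I) (s : D)
    (i : {i // i ∈ S}) : ℂ :=
  (Real.sqrt (ρ s) : ℂ) * φ i s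

lemma AstarA_sub_eq_mulVec {D I : Type*} [DecidableEq I] (ρ : D → ℝ) (φ : I → D → ℂ) {m : ℕ}
    (hm : m ≠ 0) (t : Fin m → D) {S : Finset I} {z : I → ℂ} (hz : ∀ i ∉ S, z i = 0)
    (i : {i // i ∈ S}) :
    AstarA ρ φ t z i - z i = (m : ℂ)⁻¹ *
      (((∑ k, rankOne (rowVec ρ φ S (t k))) - (m : ℂ) • (1 : Matrix {i // i ∈ S} {i // i ∈ S} ℂ))
        *ᵥ fun j => z j) i := by
  have hmC : (m : ℂ) ≠ 0 := by exact_mod_cast hm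
  have hsq : (Real.sqrt m : ℂ) * (Real.sqrt m : ℂ) = m := by
    rw [← Complex.ofReal_mul, Real.mul_self_sqrt (Nat.cast_nonneg m), Complex.ofReal_natCast]
  have hA : ∀ k, Aapp ρ φ t z k =
      ∑ j : {i // i ∈ S}, z j * (rowVec ρ φ S (t k) j / (Real.sqrt m : ℂ)) := fun k => by
    rw [Aapp, tsum_eq_sum (s := S) (fun j hj => by simp [hz j hj]), ← Finset.sum_coe_sort]
    rfl
  rw [sub_mulVec, smul_mulVec, one_mulVec, sum_mulVec]
  simp only [Pi.sub_apply, Pi.smul_apply, smul_eq_mul, Finset.sum_apply]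
  rw [mul_sub, ← mul_assoc, inv_mul_cancel₀ hmC, one_mul, AstarA, Finset.mul_sum]
  congr 1
  refine Finset.sum_congr rfl fun k _ => ?_
  rw [hA, mulVec, dotProduct, Finset.mul_sum, Finset.mul_sum]
  refine Finset.sum_congr rfl fun j _ => ?_
  rw [← hsq]
  simp only [Amat, Umat, rowVec, rankOne, vecMulVec_apply, Pi.star_apply, map_div₀, map_mul,
    Complex.conj_ofReal, star_mul', Complex.star_def]
  field_simp
end

/-- Lemma 6.2: if `m ≥ |Δ|_u · log(2|Δ|/ε) · (2δ⁻² + 2δ⁻¹/3)` then with probability at least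
`1 − ε` over i.i.d. samples `t_1,…,t_m ∼ μ`, the matrix `A = U/√m` satisfies
`‖P_Δ A* A P_Δ − P_Δ‖ ≤ δ` (operator 2-norm). -/
theorem stmt15 {D : Type*} [MeasurableSpace D] {I : Type*} [DecidableEq I] [Countable I]
    (μ : Measure D) [IsProbabilityMeasure μ]
    (ρ : D → ℝ) (hρ : ∀ s, 0 ≤ ρ s) (hρm : Measurable ρ)
    (φ : I → D → ℂ) (hφm : ∀ i, Measurable (φ i))
    (horth : ∀ i j : I,
      (∫ s, (starRingEnd ℂ) (φ i s) * φ j s * (ρ s : ℂ) ∂μ) = if i = j then 1 else 0)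
    (u : I → ℝ) (hu1 : ∀ i, 1 ≤ u i)
    (hu : ∀ i s, Real.sqrt (ρ s) * ‖φ i s‖ ≤ u i)
    (Δ : Finset I) (hΔne : Δ.Nonempty)
    (ε δ : ℝ) (hε0 : 0 < ε) (hε1 : ε < 1) (hδ : 0 < δ)
    (m : ℕ)
    (hm : (∑ i ∈ Δ, u i ^ 2) * Real.log (2 * Δ.card / ε) * (2 / δ ^ 2 + 2 / (3 * δ)) ≤ m) :
    1 - ENNReal.ofReal ε ≤
      (Measure.pi fun _ : Fin m => μ) {t : Fin m → D |
        ∀ z : I → ℂ, (∀ i ∉ Δ, z i = 0) →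
          l2I (fun i => if i ∈ Δ then AstarA ρ φ t z i - z i else 0) ≤ δ * l2I z} := by
  classical
  have hN : (1 : ℝ) ≤ Δ.card := by exact_mod_cast hΔne.card_pos
  have hsum : (1 : ℝ) ≤ ∑ i ∈ Δ, u i ^ 2 := by
    refine hN.trans ?_
    rw [← nsmul_one, ← Finset.sum_const]
    exact Finset.sum_le_sum fun i _ => one_le_pow₀ (hu1 i)
  have hm0 : (0 : ℝ) < m := by
    refine lt_of_lt_of_le ?_ hm
    have : 0 < Real.log (2 * Δ.card / ε) :=
      Real.log_pos ((one_lt_div hε0).2 (by linarith))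
    positivity
  have hmN : m ≠ 0 := by exact_mod_cast hm0.ne'
  have : Nonempty {i // i ∈ Δ} := hΔne.to_subtype
  have hnorm : ∀ s (i : {i // i ∈ Δ}), ‖rowVec ρ φ Δ s i‖ ≤ u i := fun s i => by
    rw [rowVec, norm_mul, Complex.norm_real, Real.norm_of_nonneg (Real.sqrt_nonneg _)]
    exact hu i s
  have hwm : ∀ i, Measurable fun s => rowVec ρ φ Δ s i := fun i =>
    (Complex.measurable_ofReal.comp hρm.sqrt).mul (hφm i)
  have hint : ∀ i j, Integrable (fun s => star (rowVec ρ φ Δ s i) * rowVec ρ φ Δ s j) μ :=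
    fun i j => by
      refine Integrable.of_bound (C := u i * u j)
        ((continuous_star.measurable.comp (hwm i)).mul (hwm j)).aestronglyMeasurable
        (Filter.Eventually.of_forall fun s => ?_)
      rw [norm_mul, norm_star]
      exact mul_le_mul (hnorm s i) (hnorm s j) (norm_nonneg _) (by linarith [hu1 i])
  have horth' : ∀ i j, ∫ s, star (rowVec ρ φ Δ s i) * rowVec ρ φ Δ s j ∂μ =
      if i = j then 1 else 0 := fun i j => by
    have e : ∀ s, star (rowVec ρ φ Δ s i) * rowVec ρ φ Δ s j =
        (starRingEnd ℂ) (φ i s) * φ j s * (ρ s : ℂ) := fun s => by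
      simp only [rowVec, star_mul', Complex.star_def, Complex.conj_ofReal]
      have : (ρ s : ℂ) = (Real.sqrt (ρ s) : ℂ) * (Real.sqrt (ρ s) : ℂ) := by
        rw [← Complex.ofReal_mul, Real.mul_self_sqrt (hρ s)]
      rw [this]
      ring
    simp only [e, horth, Subtype.ext_iff]
  have hw : ∀ s, ∑ i, ‖rowVec ρ φ Δ s i‖ ^ 2 ≤ ∑ i ∈ Δ, u i ^ 2 := fun s => by
    rw [← Finset.sum_coe_sort Δ fun i => u i ^ 2]
    exact Finset.sum_le_sum fun i _ => pow_le_pow_left₀ (norm_nonneg _) (hnorm s i) 2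
  refine (measure_rankOne_sum_bernstein hwm hint horth' hsum hw hε0 hδ
    (by rwa [Fintype.card_coe])).trans (measure_mono fun t ht z hz => ?_)
  rw [l2I_eq_of_forall_notMem hz, l2I_eq_of_forall_notMem (S := Δ) (fun i hi => if_neg hi)]
  have e : ∀ i : {i // i ∈ Δ}, ‖if (i : I) ∈ Δ then AstarA ρ φ t z i - z i else 0‖ ^ 2 =
      ((m : ℝ)⁻¹) ^ 2 * ‖(((∑ k, rankOne (rowVec ρ φ Δ (t k))) -
        (m : ℂ) • (1 : Matrix {i // i ∈ Δ} {i // i ∈ Δ} ℂ)).mulVec fun j => z j) i‖ ^ 2 :=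
    fun i => by
      rw [if_pos i.2, AstarA_sub_eq_mulVec ρ φ hmN t hz i, norm_mul, mul_pow]
      simp
  simp only [e]
  rw [← Finset.mul_sum, Real.sqrt_mul (by positivity), Real.sqrt_sq (by positivity)]
  calc _ ≤ (m : ℝ)⁻¹ * (m * δ * Real.sqrt (∑ i : {i // i ∈ Δ}, ‖z i‖ ^ 2)) := by
        gcongr
        exact (Matrix.sqrt_sum_norm_sq_mulVec_le _ _).trans (by gcongr; exact ht)
    _ = _ := by field_simp
end

section
/- Let Δ ⊆ I be finite with |Δ| ≥ 1, let 0 < ε < e^{-1}, δ > 0, and z ∈ ℓ²(I), and suppose m ≥ |Δ|_u · log(ε^{-1}) · (8δ^{-2} + 28δ^{-1}/3). Then, with probability at least 1 − ε over the i.i.d. draw of t_1,…,t_m from μ, the random matrix A = U/√m satisfies ‖(P_Δ A* A P_Δ − P_Δ) z‖ ≤ δ·‖z‖, where ‖·‖ denotes the ℓ² norm. -/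
open scoped BigOperators
open MeasureTheory

/-- `s ↦ cosh √s` is convex, in two-point form. -/
lemma cosh_le_of_sq_le_convex_comb {p a b v w : ℝ} (hv : 0 ≤ v) (hw : 0 ≤ w) (hvw : v + w = 1)
    (hp : p ^ 2 = v * a ^ 2 + w * b ^ 2) :
    Real.cosh p ≤ v * Real.cosh a + w * Real.cosh b := by
  refine hasSum_le (fun n => ?_) (Real.hasSum_cosh p)
    (((Real.hasSum_cosh a).mul_left v).add ((Real.hasSum_cosh b).mul_left w))
  have h := (convexOn_pow (𝕜 := ℝ) n).2 (Set.mem_Ici.2 (sq_nonneg a)) (Set.mem_Ici.2 (sq_nonneg b))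
    hv hw hvw
  simp only [smul_eq_mul, ← hp] at h
  rw [← mul_div_assoc, ← mul_div_assoc, ← add_div]
  simp only [pow_mul]
  gcongr

/-- A second-order bound for `cosh ‖x + y‖` in an inner product space. -/
lemma cosh_norm_add_le {E : Type*} [NormedAddCommGroup E] [InnerProductSpace ℝ E] (x y : E)
    (hy : ‖y‖ ≤ 1) :
    Real.cosh ‖x + y‖ ≤
      Real.cosh ‖x‖ * (1 + ‖y‖ ^ 2) + Real.sinh ‖x‖ / ‖x‖ * inner ℝ x y := by
  set r := ‖x‖ with hr
  set d := ‖y‖ with hd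
  have hr0 : 0 ≤ r := norm_nonneg x
  have hd0 : 0 ≤ d := norm_nonneg y
  obtain ⟨θ, hθ, hθ1⟩ : ∃ θ : ℝ, inner ℝ x y = θ * (r * d) ∧ |θ| ≤ 1 := by
    refine ⟨inner ℝ x y / (r * d), ?_, abs_real_inner_div_norm_mul_norm_le_one x y⟩
    by_cases h : r * d = 0
    · have := abs_real_inner_le_norm x y
      rw [← hr, ← hd, h] at this
      rw [h, mul_zero]
      exact abs_nonpos_iff.1 this
    · rw [div_mul_cancel₀ _ h]
  obtain ⟨h1, h2⟩ := abs_le.1 hθ1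
  have hcosh : Real.cosh ‖x + y‖ ≤
      Real.cosh r * Real.cosh d + θ * (Real.sinh r * Real.sinh d) := by
    have := cosh_le_of_sq_le_convex_comb (p := ‖x + y‖) (a := r + d) (b := r - d)
      (v := (1 + θ) / 2) (w := (1 - θ) / 2) (by linarith) (by linarith) (by ring)
      (by rw [norm_add_sq_real, hθ]; ring)
    rw [Real.cosh_add, Real.cosh_sub] at this
    linarith
  have hlin : Real.sinh r / r * inner ℝ x y = θ * (Real.sinh r * d) := by
    rcases eq_or_ne r 0 with h | h
    · simp [h]
    · rw [hθ]; field_simp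
  rw [hlin]
  have hs : 0 ≤ Real.sinh r := Real.sinh_nonneg_iff.2 hr0
  have hsd : d ≤ Real.sinh d := Real.self_le_sinh_iff.2 hd0
  have hsc : Real.sinh r ≤ Real.cosh r := (Real.sinh_lt_cosh r).le
  have hexp : Real.cosh d + Real.sinh d - 1 - d ≤ d ^ 2 := by
    rw [Real.cosh_add_sinh]
    exact (abs_le.1 (Real.abs_exp_sub_one_sub_id_le (by rwa [abs_of_nonneg hd0]))).2
  have hprod : Real.sinh r * (Real.sinh d - d) ≤ Real.cosh r * (Real.sinh d - d) :=
    mul_le_mul_of_nonneg_right hsc (by linarith)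
  have hprod' : θ * (Real.sinh r * (Real.sinh d - d)) ≤ Real.sinh r * (Real.sinh d - d) :=
    mul_le_of_le_one_left (mul_nonneg hs (by linarith)) h2
  nlinarith [mul_le_mul_of_nonneg_left hexp (Real.cosh_pos r).le]

section Concentration

variable {D E : Type*} [MeasurableSpace D] [NormedAddCommGroup E] [InnerProductSpace ℝ E]
  [CompleteSpace E] [SecondCountableTopology E] [MeasurableSpace E] [BorelSpace E]

lemma lintegral_cosh_norm_add_le (μ : Measure D) [IsProbabilityMeasure μ] {Y : D → E}
    (hYm : Measurable Y) (hY1 : ∀ s, ‖Y s‖ ≤ 1) (hY0 : ∫ s, Y s ∂μ = 0) {v : ℝ}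
    (hv : ∫ s, ‖Y s‖ ^ 2 ∂μ ≤ v) (x : E) :
    ∫⁻ s, ENNReal.ofReal (Real.cosh ‖x + Y s‖) ∂μ ≤
      ENNReal.ofReal (Real.cosh ‖x‖ * Real.exp v) := by
  have hYi : Integrable Y μ := .of_bound hYm.aestronglyMeasurable 1 (ae_of_all _ hY1)
  have hYi2 : Integrable (fun s => ‖Y s‖ ^ 2) μ :=
    .of_bound (hYm.norm.pow_const 2).aestronglyMeasurable 1
      (ae_of_all _ fun s => by
        rw [Real.norm_of_nonneg (by positivity)]
        exact pow_le_one₀ (norm_nonneg _) (hY1 s))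
  have hin : Integrable (fun s => inner ℝ x (Y s)) μ := hYi.const_inner x
  have hI1 : Integrable (fun s => Real.cosh ‖x‖ * (1 + ‖Y s‖ ^ 2)) μ :=
    ((integrable_const 1).add hYi2).const_mul _
  have hI2 := hin.const_mul (Real.sinh ‖x‖ / ‖x‖)
  have hpt : ∀ s, Real.cosh ‖x + Y s‖ ≤
      Real.cosh ‖x‖ * (1 + ‖Y s‖ ^ 2) + Real.sinh ‖x‖ / ‖x‖ * inner ℝ x (Y s) :=
    fun s => cosh_norm_add_le x (Y s) (hY1 s)
  calc ∫⁻ s, ENNReal.ofReal (Real.cosh ‖x + Y s‖) ∂μ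
      ≤ ∫⁻ s, ENNReal.ofReal (Real.cosh ‖x‖ * (1 + ‖Y s‖ ^ 2)
          + Real.sinh ‖x‖ / ‖x‖ * inner ℝ x (Y s)) ∂μ :=
        lintegral_mono fun s => ENNReal.ofReal_le_ofReal (hpt s)
    _ = ENNReal.ofReal (∫ s, (Real.cosh ‖x‖ * (1 + ‖Y s‖ ^ 2)
          + Real.sinh ‖x‖ / ‖x‖ * inner ℝ x (Y s)) ∂μ) :=
        (ofReal_integral_eq_lintegral_ofReal (hI1.add hI2)
          (ae_of_all _ fun s => (Real.cosh_pos _).le.trans (hpt s))).symm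
    _ ≤ ENNReal.ofReal (Real.cosh ‖x‖ * Real.exp v) := by
        refine ENNReal.ofReal_le_ofReal ?_
        rw [integral_add hI1 hI2, integral_const_mul, integral_const_mul, integral_inner hYi, hY0,
          inner_zero_right, mul_zero, add_zero, integral_add (integrable_const 1) hYi2]
        refine mul_le_mul_of_nonneg_left ?_ (Real.cosh_pos _).le
        have := Real.add_one_le_exp v
        simp only [integral_const, probReal_univ, smul_eq_mul, one_mul]
        linarith

lemma lintegral_cosh_norm_add_sum_le (μ : Measure D) [IsProbabilityMeasure μ] {Y : D → E}
    (hYm : Measurable Y) (hY1 : ∀ s, ‖Y s‖ ≤ 1) (hY0 : ∫ s, Y s ∂μ = 0) {v : ℝ}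
    (hv : ∫ s, ‖Y s‖ ^ 2 ∂μ ≤ v) (m : ℕ) (x : E) :
    ∫⁻ t, ENNReal.ofReal (Real.cosh ‖x + ∑ k, Y (t k)‖) ∂(Measure.pi fun _ : Fin m => μ) ≤
      ENNReal.ofReal (Real.cosh ‖x‖ * Real.exp (m * v)) := by
  induction m generalizing x with
  | zero => simp
  | succ n ih =>
    rw [← ((measurePreserving_piFinSuccAbove (fun _ : Fin (n + 1) => μ) 0).symm).lintegral_comp
      (by fun_prop)]
    simp only [MeasurableEquiv.piFinSuccAbove_symm_apply, Fin.insertNthEquiv, Equiv.coe_fn_mk,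
      Fin.sum_univ_succ, Fin.insertNth_zero', Fin.cons_zero, Fin.cons_succ, ← add_assoc]
    rw [lintegral_prod _ (by fun_prop)]
    calc _ ≤ ∫⁻ s, ENNReal.ofReal (Real.cosh ‖x + Y s‖ * Real.exp (n * v)) ∂μ :=
          lintegral_mono fun s => ih (x + Y s)
      _ = (∫⁻ s, ENNReal.ofReal (Real.cosh ‖x + Y s‖) ∂μ) * ENNReal.ofReal (Real.exp (n * v)) := by
          simp_rw [ENNReal.ofReal_mul (Real.cosh_pos _).le]
          exact lintegral_mul_const _ (by fun_prop)
      _ ≤ ENNReal.ofReal (Real.cosh ‖x‖ * Real.exp v) * ENNReal.ofReal (Real.exp (n * v)) := by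
          gcongr
          exact lintegral_cosh_norm_add_le μ hYm hY1 hY0 hv x
      _ = _ := by
          rw [← ENNReal.ofReal_mul (by positivity), mul_assoc, ← Real.exp_add]
          congr 3
          push_cast
          ring

/-- A Bernstein-type tail bound for sums of independent, identically distributed, centred and
bounded Hilbert-space-valued random variables. -/
lemma measure_pi_le_norm_sum_le (μ : Measure D) [IsProbabilityMeasure μ] {Y : D → E}
    (hYm : Measurable Y) {B l : ℝ} (hYB : ∀ s, ‖Y s‖ ≤ B) (hY0 : ∫ s, Y s ∂μ = 0) {v : ℝ}
    (hv : ∫ s, ‖Y s‖ ^ 2 ∂μ ≤ v) (m : ℕ) (hl0 : 0 ≤ l) (hlB : l * B ≤ 1) (T : ℝ) :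
    (Measure.pi fun _ : Fin m => μ) {t | T ≤ ‖∑ k, Y (t k)‖} ≤
      ENNReal.ofReal (2 * Real.exp (m * (l ^ 2 * v) - l * T)) := by
  have hnorm : ∀ y : E, ‖l • y‖ = l * ‖y‖ := fun y => by
    rw [norm_smul, Real.norm_of_nonneg hl0]
  have key := lintegral_cosh_norm_add_sum_le μ (Y := fun s => l • Y s) (v := l ^ 2 * v)
    (hYm.const_smul l)
    (fun s => (hnorm _).trans_le ((mul_le_mul_of_nonneg_left (hYB s) hl0).trans hlB))
    (by rw [integral_smul, hY0, smul_zero])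
    (by
      simp_rw [hnorm, mul_pow]
      rw [integral_const_mul]
      gcongr) m 0
  simp only [zero_add, norm_zero, Real.cosh_zero, one_mul, ← Finset.smul_sum, hnorm] at key
  set c := Real.exp (l * T) / 2 with hc
  have hc0 : 0 < c := by positivity
  calc (Measure.pi fun _ : Fin m => μ) {t | T ≤ ‖∑ k, Y (t k)‖}
      ≤ (Measure.pi fun _ : Fin m => μ)
          {t | ENNReal.ofReal c ≤ ENNReal.ofReal (Real.cosh (l * ‖∑ k, Y (t k)‖))} := by
        refine measure_mono fun t (ht : T ≤ _) => ENNReal.ofReal_le_ofReal ?_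
        rw [Real.cosh_eq]
        have : Real.exp (l * T) ≤ Real.exp (l * ‖∑ k, Y (t k)‖) := by gcongr
        have := Real.exp_pos (-(l * ‖∑ k, Y (t k)‖))
        linarith
    _ ≤ _ := meas_ge_le_lintegral_div (Measurable.aemeasurable (by fun_prop))
        (by simpa using hc0) ENNReal.ofReal_ne_top
    _ ≤ ENNReal.ofReal (Real.exp (m * (l ^ 2 * v))) / ENNReal.ofReal c := by gcongr
    _ = _ := by
        rw [← ENNReal.ofReal_div_of_pos hc0, hc, Real.exp_sub]
        congr 1
        field_simp

lemma measure_pi_lt_norm_sum_le_of_sample_size (μ : Measure D) [IsProbabilityMeasure μ] {Y : D → E}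
    (hYm : Measurable Y) {K N : ℝ} (hK : 1 ≤ K) (hN : 0 ≤ N) (hYB : ∀ s, ‖Y s‖ ≤ 2 * K * N)
    (hY0 : ∫ s, Y s ∂μ = 0) (hv : ∫ s, ‖Y s‖ ^ 2 ∂μ ≤ K * N ^ 2)
    {ε δ : ℝ} (hε0 : 0 < ε) (hε1 : ε < Real.exp (-1)) (hδ : 0 < δ) (m : ℕ)
    (hm : K * Real.log (1 / ε) * (8 / δ ^ 2 + 28 / (3 * δ)) ≤ m) :
    (Measure.pi fun _ : Fin m => μ) {t | m * δ * N < ‖∑ k, Y (t k)‖} ≤ ENNReal.ofReal ε := by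
  have hK0 : 0 < K := by linarith
  rcases hN.eq_or_lt with rfl | hN
  · have hY : ∀ s, Y s = 0 := fun s => norm_le_zero_iff.1 (by simpa using hYB s)
    simp [hY]
  set L := Real.log (1 / ε) with hL
  have hLε : L = -Real.log ε := by rw [hL, one_div, Real.log_inv]
  have hL1 : 1 < L := by
    have := (Real.log_lt_iff_lt_exp hε0).2 hε1
    linarith
  have hεL : Real.exp (-L) = ε := by rw [hLε, neg_neg, Real.exp_log hε0]
  obtain ⟨c, hc0, hc1, hc⟩ : ∃ c : ℝ, 0 ≤ c ∧ c ≤ 1 / 2 ∧ 2 * L * K ≤ m * (c * δ - c ^ 2) := by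
    have hmδ : L * K * (8 / δ ^ 2) ≤ m := by
      refine le_trans ?_ hm
      have : 0 ≤ K * L * (28 / (3 * δ)) := by positivity
      linarith
    have hmδ' : L * K * (28 / (3 * δ)) ≤ m := by
      refine le_trans ?_ hm
      have : 0 ≤ K * L * (8 / δ ^ 2) := by positivity
      linarith
    rcases le_total δ 1 with h | h
    · refine ⟨δ / 2, by linarith, by linarith, ?_⟩
      calc 2 * L * K = L * K * (8 / δ ^ 2) * (δ ^ 2 / 4) := by field_simp; norm_num
        _ ≤ m * (δ ^ 2 / 4) := by gcongr
        _ = _ := by ring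
    · refine ⟨1 / 2, by norm_num, le_rfl, ?_⟩
      have hLK : 0 ≤ L * K := by positivity
      calc 2 * L * K ≤ L * K * (28 / (3 * δ)) * (δ / 4) := by
            field_simp; norm_num
        _ ≤ m * (δ / 4) := by gcongr
        _ ≤ m * (1 / 2 * δ - (1 / 2) ^ 2) := by
            gcongr
            linarith
  have hKN : 0 < K * N := by positivity
  calc (Measure.pi fun _ : Fin m => μ) {t | m * δ * N < ‖∑ k, Y (t k)‖}
      ≤ (Measure.pi fun _ : Fin m => μ) {t | m * δ * N ≤ ‖∑ k, Y (t k)‖} :=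
        measure_mono (Set.ofPred_subset_ofPred.2 fun _ ht => ht.le)
    _ ≤ _ := measure_pi_le_norm_sum_le μ hYm (l := c / (K * N)) hYB hY0 hv m (by positivity)
        (by
          rw [div_mul_eq_mul_div, div_le_one hKN]
          nlinarith) _
    _ ≤ ENNReal.ofReal (2 * Real.exp (-(2 * L))) := by
        gcongr
        have : m * ((c / (K * N)) ^ 2 * (K * N ^ 2)) - c / (K * N) * (m * δ * N)
            = -(m * (c * δ - c ^ 2) / K) := by
          field_simp
          ring
        rw [this, neg_le_neg_iff, le_div_iff₀ hK0]
        exact hc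
    _ ≤ ENNReal.ofReal ε := by
        refine ENNReal.ofReal_le_ofReal ?_
        have h1 : ε ≤ 1 / 2 := by
          have h2 := Real.add_one_le_exp (1 : ℝ)
          rw [Real.exp_neg] at hε1
          have : (Real.exp 1)⁻¹ ≤ 1 / 2 := by
            rw [one_div]
            exact inv_anti₀ (by norm_num) (by linarith)
          linarith
        rw [show -(2 * L) = -L + -L by ring, Real.exp_add, hεL]
        nlinarith

end Concentration

section Sampling

variable {D I : Type*}

/-- The restriction to `Δ` of the adjoint of a row of `U`, as a function of the sampling point. -/
noncomputable def adjointRow (ρ : D → ℝ) (φ : I → D → ℂ) (Δ : Finset I) (s : D) :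
    EuclideanSpace ℂ Δ :=
  WithLp.toLp 2 fun i => (starRingEnd ℂ) ((Real.sqrt (ρ s) : ℂ) * φ i s)

lemma measurable_adjointRow [MeasurableSpace D] {ρ : D → ℝ} (hρm : Measurable ρ) {φ : I → D → ℂ}
    (hφm : ∀ i, Measurable (φ i)) (Δ : Finset I) : Measurable (adjointRow ρ φ Δ) := by
  refine (WithLp.measurable_toLp 2 _).comp (measurable_pi_lambda _ fun i => ?_)
  have := hφm i
  fun_prop

lemma norm_adjointRow_sq_le {ρ : D → ℝ} {φ : I → D → ℂ} {u : I → ℝ}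
    (hu : ∀ i s, Real.sqrt (ρ s) * ‖φ i s‖ ≤ u i) (Δ : Finset I) (s : D) :
    ‖adjointRow ρ φ Δ s‖ ^ 2 ≤ ∑ i ∈ Δ, u i ^ 2 := by
  rw [EuclideanSpace.norm_sq_eq, ← Finset.sum_coe_sort Δ]
  refine Finset.sum_le_sum fun i _ => ?_
  simp only [adjointRow, RCLike.norm_conj, norm_mul, Complex.norm_real,
    Real.norm_of_nonneg (Real.sqrt_nonneg _)]
  exact pow_le_pow_left₀ (by positivity) (hu i s) 2

/-- The rank-one operator given by `adjointRow`, applied to `y`. -/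
noncomputable def rankOneRow (ρ : D → ℝ) (φ : I → D → ℂ) (Δ : Finset I)
    (y : EuclideanSpace ℂ Δ) (s : D) : EuclideanSpace ℂ Δ :=
  inner ℂ (adjointRow ρ φ Δ s) y • adjointRow ρ φ Δ s

lemma measurable_rankOneRow [MeasurableSpace D] {ρ : D → ℝ} (hρm : Measurable ρ)
    {φ : I → D → ℂ} (hφm : ∀ i, Measurable (φ i)) (Δ : Finset I) (y : EuclideanSpace ℂ Δ) :
    Measurable (rankOneRow ρ φ Δ y) :=
  have h := measurable_adjointRow hρm hφm Δ
  Measurable.smul (f := fun s => inner ℂ (adjointRow ρ φ Δ s) y) (h.inner measurable_const) h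

lemma norm_rankOneRow_le {ρ : D → ℝ} {φ : I → D → ℂ} {u : I → ℝ}
    (hu : ∀ i s, Real.sqrt (ρ s) * ‖φ i s‖ ≤ u i) (Δ : Finset I) (y : EuclideanSpace ℂ Δ) (s : D) :
    ‖rankOneRow ρ φ Δ y s‖ ≤ (∑ i ∈ Δ, u i ^ 2) * ‖y‖ := by
  rw [rankOneRow, norm_smul]
  calc _ ≤ ‖adjointRow ρ φ Δ s‖ * ‖y‖ * ‖adjointRow ρ φ Δ s‖ := by
        gcongr
        exact norm_inner_le_norm _ _
    _ = ‖adjointRow ρ φ Δ s‖ ^ 2 * ‖y‖ := by ring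
    _ ≤ _ := by
        gcongr
        exact norm_adjointRow_sq_le hu Δ s

lemma rankOneRow_apply {ρ : D → ℝ} (hρ : ∀ s, 0 ≤ ρ s) (φ : I → D → ℂ) (Δ : Finset I)
    (y : EuclideanSpace ℂ Δ) (s : D) (i : Δ) :
    rankOneRow ρ φ Δ y s i =
      ∑ j : Δ, y j * ((starRingEnd ℂ) (φ i s) * φ j s * (ρ s : ℂ)) := by
  have h : (Real.sqrt (ρ s) : ℂ) * (Real.sqrt (ρ s) : ℂ) = (ρ s : ℂ) := by
    rw [← Complex.ofReal_mul, Real.mul_self_sqrt (hρ s)]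
  simp only [rankOneRow, adjointRow, PiLp.smul_apply, smul_eq_mul, PiLp.inner_apply,
    RCLike.inner_apply, Complex.conj_conj, map_mul, Complex.conj_ofReal, Finset.sum_mul, ← h]
  exact Finset.sum_congr rfl fun j _ => by ring

lemma integral_rankOneRow [MeasurableSpace D] (μ : Measure D) [IsProbabilityMeasure μ]
    [DecidableEq I] {ρ : D → ℝ} (hρ : ∀ s, 0 ≤ ρ s) (hρm : Measurable ρ)
    {φ : I → D → ℂ} (hφm : ∀ i, Measurable (φ i))
    (horth : ∀ i j : I,
      (∫ s, (starRingEnd ℂ) (φ i s) * φ j s * (ρ s : ℂ) ∂μ) = if i = j then 1 else 0)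
    {u : I → ℝ} (hu : ∀ i s, Real.sqrt (ρ s) * ‖φ i s‖ ≤ u i) (Δ : Finset I)
    (y : EuclideanSpace ℂ Δ) : ∫ s, rankOneRow ρ φ Δ y s ∂μ = y := by
  have hi : ∀ i j : I, Integrable (fun s => (starRingEnd ℂ) (φ i s) * φ j s * (ρ s : ℂ)) μ := by
    refine fun i j => .of_bound ?_ (u i * u j) (ae_of_all _ fun s => ?_)
    · have := hφm i
      have := hφm j
      exact Measurable.aestronglyMeasurable (by fun_prop)
    · have h0 : ∀ i, 0 ≤ Real.sqrt (ρ s) * ‖φ i s‖ := fun i => by positivity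
      calc _ = (Real.sqrt (ρ s) * ‖φ i s‖) * (Real.sqrt (ρ s) * ‖φ j s‖) := by
            rw [norm_mul, norm_mul, RCLike.norm_conj, Complex.norm_real,
              Real.norm_of_nonneg (hρ s)]
            nth_rw 1 [← Real.mul_self_sqrt (hρ s)]
            ring
        _ ≤ _ := mul_le_mul (hu i s) (hu j s) (h0 j) ((h0 i).trans (hu i s))
  have hiy : ∀ i j : Δ,
      Integrable (fun s => y j * ((starRingEnd ℂ) (φ i s) * φ j s * (ρ s : ℂ))) μ :=
    fun i j => (hi i j).const_mul _
  ext i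
  rw [eval_integral_piLp fun i => ?_]
  · simp_rw [rankOneRow_apply hρ]
    rw [integral_finsetSum _ fun j _ => hiy i j]
    simp_rw [integral_const_mul, horth]
    simp
  · simp_rw [rankOneRow_apply hρ]
    exact integrable_finsetSum _ fun j _ => hiy i j

lemma integral_norm_rankOneRow_sub_sq_le [MeasurableSpace D] (μ : Measure D)
    [IsProbabilityMeasure μ] {ρ : D → ℝ} (hρm : Measurable ρ)
    {φ : I → D → ℂ} (hφm : ∀ i, Measurable (φ i))
    {u : I → ℝ} (hu : ∀ i s, Real.sqrt (ρ s) * ‖φ i s‖ ≤ u i) (Δ : Finset I)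
    (y : EuclideanSpace ℂ Δ) (hy : ∫ s, rankOneRow ρ φ Δ y s ∂μ = y) :
    ∫ s, ‖rankOneRow ρ φ Δ y s - y‖ ^ 2 ∂μ ≤ (∑ i ∈ Δ, u i ^ 2) * ‖y‖ ^ 2 := by
  set K := ∑ i ∈ Δ, u i ^ 2
  have hVm := measurable_adjointRow hρm hφm Δ
  have hXm := measurable_rankOneRow hρm hφm Δ y
  have hXi : Integrable (rankOneRow ρ φ Δ y) μ :=
    .of_bound hXm.aestronglyMeasurable _ (ae_of_all _ (norm_rankOneRow_le hu Δ y))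
  have hin : ∀ s, inner ℂ y (rankOneRow ρ φ Δ y s) =
      ((‖inner ℂ (adjointRow ρ φ Δ s) y‖ ^ 2 : ℝ) : ℂ) := fun s => by
    rw [rankOneRow, inner_smul_right, ← inner_conj_symm y, Complex.mul_conj,
      Complex.normSq_eq_norm_sq]
  have hw : ∫ s, ‖inner ℂ (adjointRow ρ φ Δ s) y‖ ^ 2 ∂μ = ‖y‖ ^ 2 := by
    have h := integral_inner (𝕜 := ℂ) hXi y
    simp_rw [hin] at h
    rw [hy, integral_complex_ofReal, inner_self_eq_norm_sq_to_K] at h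
    exact Complex.ofReal_injective (h.trans (Complex.ofReal_pow _ _).symm)
  have hwi : Integrable (fun s => ‖inner ℂ (adjointRow ρ φ Δ s) y‖ ^ 2) μ := by
    have h := (hXi.const_inner (𝕜 := ℂ) y).re
    simpa only [hin, RCLike.re_to_complex, Complex.ofReal_re] using h
  have hpt : ∀ s, ‖rankOneRow ρ φ Δ y s - y‖ ^ 2 ≤
      (K - 2) * ‖inner ℂ (adjointRow ρ φ Δ s) y‖ ^ 2 + ‖y‖ ^ 2 := fun s => by
    rw [norm_sub_sq (𝕜 := ℂ), inner_re_symm, hin, rankOneRow, norm_smul, mul_pow,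
      RCLike.re_to_complex, Complex.ofReal_re]
    have := mul_le_mul_of_nonneg_left (norm_adjointRow_sq_le hu Δ s)
      (sq_nonneg ‖inner ℂ (adjointRow ρ φ Δ s) y‖)
    linarith
  calc _ ≤ ∫ s, ((K - 2) * ‖inner ℂ (adjointRow ρ φ Δ s) y‖ ^ 2 + ‖y‖ ^ 2) ∂μ :=
        integral_mono_of_nonneg (ae_of_all _ fun s => sq_nonneg _)
          ((hwi.const_mul _).add (integrable_const _)) (ae_of_all _ hpt)
    _ = (K - 1) * ‖y‖ ^ 2 := by
        rw [integral_add (hwi.const_mul _) (integrable_const _), integral_const_mul, hw]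
        simp only [integral_const, probReal_univ, smul_eq_mul, one_mul]
        ring
    _ ≤ K * ‖y‖ ^ 2 := by
        gcongr
        linarith

lemma AstarA_proj_apply [DecidableEq I] {ρ : D → ℝ} (hρ : ∀ s, 0 ≤ ρ s) (φ : I → D → ℂ)
    (Δ : Finset I) (z : I → ℂ) {m : ℕ} (t : Fin m → D) (i : Δ) :
    AstarA ρ φ t (proj Δ z) i =
      (∑ k, rankOneRow ρ φ Δ (WithLp.toLp 2 fun i => z i) (t k) i) / m := by
  have h : ∀ s, (Real.sqrt (ρ s) : ℂ) * (Real.sqrt (ρ s) : ℂ) = (ρ s : ℂ) := fun s => by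
    rw [← Complex.ofReal_mul, Real.mul_self_sqrt (hρ s)]
  have hm : (Real.sqrt m : ℂ) * (Real.sqrt m : ℂ) = m := by
    rw [← Complex.ofReal_mul, Real.mul_self_sqrt m.cast_nonneg, Complex.ofReal_natCast]
  rw [AstarA, Finset.sum_div]
  refine Finset.sum_congr rfl fun k _ => ?_
  have hA : Aapp ρ φ t (proj Δ z) k = ∑ j : Δ, z j * Amat ρ φ t k j := by
    rw [Aapp, tsum_eq_sum (s := Δ) fun j hj => by simp [proj, hj], ← Finset.sum_coe_sort Δ]
    exact Finset.sum_congr rfl fun j _ => by simp [proj]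
  rw [hA, rankOneRow_apply hρ, Finset.mul_sum, Finset.sum_div]
  refine Finset.sum_congr rfl fun j _ => ?_
  simp only [Amat, Umat, map_div₀, map_mul, Complex.conj_ofReal]
  rw [← h, ← hm]
  simp only [div_eq_mul_inv, mul_inv]
  ring

lemma l2I_AstarA_proj_sub [DecidableEq I] {ρ : D → ℝ} (hρ : ∀ s, 0 ≤ ρ s) (φ : I → D → ℂ)
    (Δ : Finset I) (z : I → ℂ) {m : ℕ} (hm : m ≠ 0) (t : Fin m → D) :
    l2I (fun i => if i ∈ Δ then AstarA ρ φ t (proj Δ z) i - z i else 0) =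
      ‖∑ k, (rankOneRow ρ φ Δ (WithLp.toLp 2 fun i => z i) (t k)
        - WithLp.toLp 2 fun i : Δ => z i)‖ / m := by
  have hm' : (m : ℂ) ≠ 0 := Nat.cast_ne_zero.2 hm
  rw [l2I, tsum_eq_sum (s := Δ) fun j hj => by simp [hj], ← Finset.sum_coe_sort Δ,
    EuclideanSpace.norm_eq]
  rw [← Real.sqrt_sq (Nat.cast_nonneg (α := ℝ) m), ← Real.sqrt_div (by positivity),
    Finset.sum_div]
  congr 1
  refine Finset.sum_congr rfl fun i _ => ?_
  have : AstarA ρ φ t (proj Δ z) i - z i = (∑ k, (rankOneRow ρ φ Δ (WithLp.toLp 2 fun i => z i)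
      (t k) - WithLp.toLp 2 fun i : Δ => z i)) i / m := by
    rw [AstarA_proj_apply hρ, Finset.sum_sub_distrib, PiLp.sub_apply]
    simp [sub_div, hm']
  rw [if_pos i.2, this, norm_div, Complex.norm_natCast, div_pow]

lemma norm_restrict_le_l2I (Δ : Finset I) {z : I → ℂ} (hz : Summable fun i => ‖z i‖ ^ 2) :
    ‖(WithLp.toLp 2 fun i : Δ => z i : EuclideanSpace ℂ Δ)‖ ≤ l2I z := by
  rw [EuclideanSpace.norm_eq, l2I]
  refine Real.sqrt_le_sqrt ?_
  rw [Finset.sum_coe_sort Δ fun i => ‖z i‖ ^ 2]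
  exact hz.sum_le_tsum Δ fun i _ => sq_nonneg _

end Sampling

/-- Lemma 6.3: for fixed `z ∈ ℓ²(I)`, if `m ≥ |Δ|_u · log(ε⁻¹) · (8δ⁻² + 28δ⁻¹/3)` then with
probability at least `1 − ε` over i.i.d. samples from `μ`,
`‖(P_Δ A* A P_Δ − P_Δ) z‖ ≤ δ‖z‖`. -/
theorem stmt16 {D : Type*} [MeasurableSpace D] {I : Type*} [DecidableEq I] [Countable I]
    (μ : Measure D) [IsProbabilityMeasure μ]
    (ρ : D → ℝ) (hρ : ∀ s, 0 ≤ ρ s) (hρm : Measurable ρ)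
    (φ : I → D → ℂ) (hφm : ∀ i, Measurable (φ i))
    (horth : ∀ i j : I,
      (∫ s, (starRingEnd ℂ) (φ i s) * φ j s * (ρ s : ℂ) ∂μ) = if i = j then 1 else 0)
    (u : I → ℝ) (hu1 : ∀ i, 1 ≤ u i)
    (hu : ∀ i s, Real.sqrt (ρ s) * ‖φ i s‖ ≤ u i)
    (Δ : Finset I) (hΔne : Δ.Nonempty)
    (ε δ : ℝ) (hε0 : 0 < ε) (hε1 : ε < Real.exp (-1)) (hδ : 0 < δ)
    (z : I → ℂ) (hz : Summable fun i => ‖z i‖ ^ 2)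
    (m : ℕ)
    (hm : (∑ i ∈ Δ, u i ^ 2) * Real.log (1 / ε) * (8 / δ ^ 2 + 28 / (3 * δ)) ≤ m) :
    1 - ENNReal.ofReal ε ≤
      (Measure.pi fun _ : Fin m => μ) {t : Fin m → D |
        l2I (fun i => if i ∈ Δ then AstarA ρ φ t (proj Δ z) i - z i else 0) ≤ δ * l2I z} := by
  set K := ∑ i ∈ Δ, u i ^ 2 with hKdef
  have hK : 1 ≤ K := by
    obtain ⟨i, hi⟩ := hΔne
    calc (1 : ℝ) ≤ u i ^ 2 := one_le_pow₀ (hu1 i)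
      _ ≤ K := Finset.single_le_sum (f := fun i => u i ^ 2) (fun i _ => sq_nonneg _) hi
  have hm0 : m ≠ 0 := by
    rintro rfl
    have hL : 0 < Real.log (1 / ε) := by
      refine Real.log_pos ?_
      rw [lt_div_iff₀ hε0, one_mul]
      exact hε1.trans (Real.exp_zero ▸ Real.exp_lt_exp.2 (by norm_num))
    have : 0 < K * Real.log (1 / ε) * (8 / δ ^ 2 + 28 / (3 * δ)) := by positivity
    rw [Nat.cast_zero] at hm
    linarith
  have hmR : (0 : ℝ) < m := by positivity
  set y : EuclideanSpace ℂ Δ := WithLp.toLp 2 fun i => z i with hy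
  have hint := integral_rankOneRow μ hρ hρm hφm horth hu Δ y
  have hXm := measurable_rankOneRow hρm hφm Δ y
  have hXi : Integrable (rankOneRow ρ φ Δ y) μ :=
    .of_bound hXm.aestronglyMeasurable _ (ae_of_all _ (norm_rankOneRow_le hu Δ y))
  have key := measure_pi_lt_norm_sum_le_of_sample_size μ
    (Y := fun s => rankOneRow ρ φ Δ y s - y) (hXm.sub_const y) hK (norm_nonneg y)
    (fun s => by
      refine (norm_sub_le _ _).trans ?_
      have := norm_rankOneRow_le hu Δ y s
      nlinarith [norm_nonneg y])
    (by
      rw [integral_sub hXi (integrable_const y), hint]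
      simp)
    (integral_norm_rankOneRow_sub_sq_le μ hρm hφm hu Δ y hint) hε0 hε1 hδ m hm
  set P := Measure.pi fun _ : Fin m => μ
  set S := {t : Fin m → D |
    l2I (fun i => if i ∈ Δ then AstarA ρ φ t (proj Δ z) i - z i else 0) ≤ δ * l2I z} with hS
  have hsub : Sᶜ ⊆ {t | m * δ * ‖y‖ < ‖∑ k, (rankOneRow ρ φ Δ y (t k) - y)‖} := by
    intro t ht
    rw [hS, Set.mem_compl_iff, Set.mem_ofPred_eq, not_le, l2I_AstarA_proj_sub hρ φ Δ z hm0,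
      lt_div_iff₀ hmR] at ht
    refine lt_of_le_of_lt ?_ ht
    have := mul_le_mul_of_nonneg_left (norm_restrict_le_l2I Δ hz) (mul_pos hmR hδ).le
    linarith
  rw [tsub_le_iff_right]
  calc (1 : ENNReal) = P (S ∪ Sᶜ) := by rw [Set.union_compl_self, measure_univ]
    _ ≤ P S + P Sᶜ := measure_union_le _ _
    _ ≤ P S + ENNReal.ofReal ε := by
        gcongr
        exact (measure_mono hsub).trans key
end

section
/- Let 0 < ε < 1, δ > 0, w = (w_i)_{i∈I} positive weights, I_K ⊆ I finite with N := |I_K|, and Δ ⊆ I_K with Δ ≠ I_K and w_i ≥ 1 for all i ∈ I_K ∖ Δ. Suppose m ≥ 2·(max_{i∈I_K∖Δ} u_i²/w_i²)·log(2N/ε)·(δ^{-2} + δ^{-1}/3). Then, with probability at least 1 − ε over the i.i.d. draw of t_1,…,t_m from μ, the random matrix A = U/√m satisfies max_{i∈I_K∖Δ} ‖A e_i‖ / w_i ≤ √(1+δ), where A e_i ∈ ℂ^m is the i-th column of A and ‖·‖ the ℓ² norm. -/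
open scoped BigOperators
open MeasureTheory

/-- The lower bound on Bennett's function that gives the Bernstein form of the tail bound. -/
lemma bennett_lower_bound {x : ℝ} (hx : 0 ≤ x) :
    3 * x ^ 2 / (2 * (3 + x)) ≤ (1 + x) * Real.log (1 + x) - x := by
  let f : ℝ → ℝ := fun y => (1 + y) * Real.log (1 + y) - y - 3 * y ^ 2 / (2 * (3 + y))
  have hderiv : ∀ y, 0 ≤ y → HasDerivAt f
      (Real.log (1 + y) - 3 * (y ^ 2 + 6 * y) / (2 * (3 + y) ^ 2)) y := by
    intro y hy
    have h1 : HasDerivAt (fun y : ℝ => 1 + y) 1 y := (hasDerivAt_id y).const_add 1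
    have h3 : HasDerivAt (fun y : ℝ => 2 * (3 + y)) (2 * 1) y :=
      ((hasDerivAt_id y).const_add 3).const_mul 2
    have hq : HasDerivAt (fun y : ℝ => 3 * y ^ 2) (3 * (2 * y)) y := by
      simpa using (hasDerivAt_pow 2 y).const_mul 3
    have h := ((h1.mul (h1.log (by positivity))).sub (hasDerivAt_id y)).sub
      (hq.div h3 (by positivity))
    convert! h using 1
    field_simp
    ring
  have hmono : MonotoneOn f (Set.Ici 0) := by
    refine monotoneOn_of_deriv_nonneg (convex_Ici 0)
      (fun y hy => (hderiv y hy).continuousAt.continuousWithinAt) ?_ ?_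
    · intro y hy
      rw [interior_Ici] at hy
      exact (hderiv y hy.le).differentiableAt.differentiableWithinAt
    · intro y hy
      rw [interior_Ici] at hy
      have hy : 0 < y := hy
      rw [(hderiv y hy.le).deriv, sub_nonneg]
      refine le_trans ?_ (Real.le_log_one_add_of_nonneg hy.le)
      rw [div_le_div_iff₀ (by positivity) (by positivity)]
      nlinarith [pow_pos hy 3]
  have h := hmono (Set.mem_Ici.mpr le_rfl) (Set.mem_Ici.mpr hx) hx
  simp only [f] at h
  norm_num at h
  linarith

lemma exp_mul_le_one_add {a y c : ℝ} (ha : 0 < a) (hy0 : 0 ≤ y) (hya : y ≤ a) :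
    Real.exp (c * y) ≤ 1 + y * ((Real.exp (c * a) - 1) / a) := by
  have h := convexOn_exp.2 (Set.mem_univ 0) (Set.mem_univ (c * a))
    (sub_nonneg.mpr ((div_le_one ha).mpr hya)) (div_nonneg hy0 ha.le) (by ring)
  simp only [smul_eq_mul, mul_zero, zero_add, Real.exp_zero, mul_one] at h
  calc Real.exp (c * y) = Real.exp (y / a * (c * a)) := by congr 1; field_simp
    _ ≤ _ := h
    _ = _ := by ring

open ProbabilityTheory in
/-- Bennett's upper tail bound for sums of i.i.d. nonnegative bounded variables. -/
lemma measureReal_sum_ge_le_exp {D : Type*} [MeasurableSpace D] (μ : Measure D)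
    [IsProbabilityMeasure μ] {Y : D → ℝ} (hYm : Measurable Y) {a δ : ℝ} (ha : 0 < a)
    (hδ : 0 ≤ δ) (hY0 : ∀ s, 0 ≤ Y s) (hYa : ∀ s, Y s ≤ a) (hmean : ∫ s, Y s ∂μ ≤ 1) (m : ℕ) :
    (Measure.pi fun _ : Fin m => μ).real {t | (1 + δ) * m ≤ ∑ k, Y (t k)} ≤
      Real.exp (-(m / a * (3 * δ ^ 2 / (2 * (3 + δ))))) := by
  set c := Real.log (1 + δ) / a with hc
  have hlog : 0 ≤ Real.log (1 + δ) := Real.log_nonneg (by linarith)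
  have hc0 : 0 ≤ c := by positivity
  have hca : Real.exp (c * a) = 1 + δ := by
    rw [hc, div_mul_cancel₀ _ ha.ne', Real.exp_log (by linarith)]
  have hYint : Integrable Y μ := Integrable.of_bound hYm.aestronglyMeasurable a
    (.of_forall fun s => by rw [Real.norm_of_nonneg (hY0 s)]; exact hYa s)
  have hexpint : Integrable (fun s => Real.exp (c * Y s)) μ :=
    Integrable.of_bound (by fun_prop) (Real.exp (c * a)) (.of_forall fun s => by
      rw [Real.norm_of_nonneg (Real.exp_pos _).le]
      exact Real.exp_le_exp.mpr (mul_le_mul_of_nonneg_left (hYa s) hc0))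
  have hmgf : ∫ s, Real.exp (c * Y s) ∂μ ≤ Real.exp (δ / a) := by
    calc ∫ s, Real.exp (c * Y s) ∂μ ≤ ∫ s, (1 + Y s * (δ / a)) ∂μ := by
          refine integral_mono hexpint ((integrable_const 1).add (hYint.mul_const _)) fun s => ?_
          have h := exp_mul_le_one_add (c := c) ha (hY0 s) (hYa s)
          rwa [hca, add_sub_cancel_left] at h
      _ = 1 + (∫ s, Y s ∂μ) * (δ / a) := by
          rw [integral_add (integrable_const 1) (hYint.mul_const _), integral_mul_const]
          simp
      _ ≤ 1 + δ / a := by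
          gcongr
          exact mul_le_of_le_one_left (by positivity) hmean
      _ ≤ Real.exp (δ / a) := by linarith [Real.add_one_le_exp (δ / a)]
  have hprod : ∀ t : Fin m → D, Real.exp (c * ∑ k, Y (t k)) = ∏ k, Real.exp (c * Y (t k)) := by
    intro t
    rw [Finset.mul_sum, Real.exp_sum]
  have hint : Integrable (fun t : Fin m → D => Real.exp (c * ∑ k, Y (t k)))
      (Measure.pi fun _ => μ) := by
    simp only [hprod]
    exact Integrable.fintype_prod fun _ => hexpint
  refine (measure_ge_le_exp_mul_mgf _ hc0 hint).trans ?_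
  have hmgf_sum : mgf (fun t : Fin m → D => ∑ k, Y (t k)) (Measure.pi fun _ => μ) c
      = (∫ s, Real.exp (c * Y s) ∂μ) ^ m := by
    simp only [mgf, hprod]
    rw [integral_fintype_prod_eq_prod (fun _ : Fin m => fun s => Real.exp (c * Y s))]
    simp
  rw [hmgf_sum]
  calc Real.exp (-c * ((1 + δ) * m)) * (∫ s, Real.exp (c * Y s) ∂μ) ^ m
      ≤ Real.exp (-c * ((1 + δ) * m)) * Real.exp (δ / a) ^ m := by gcongr
    _ = Real.exp (-(m / a * ((1 + δ) * Real.log (1 + δ) - δ))) := by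
        rw [← Real.exp_nat_mul, ← Real.exp_add, hc]
        congr 1
        ring
    _ ≤ _ := by
        gcongr
        exact bennett_lower_bound hδ

lemma sum_norm_Amat_sq {D I : Type*} {ρ : D → ℝ} (hρ : ∀ s, 0 ≤ ρ s) (φ : I → D → ℂ) {m : ℕ}
    (t : Fin m → D) (i : I) :
    ∑ k, ‖Amat ρ φ t k i‖ ^ 2 = (∑ k, ρ (t k) * ‖φ i (t k)‖ ^ 2) / m := by
  rw [Finset.sum_div]
  refine Finset.sum_congr rfl fun k _ => ?_
  rw [Amat, Umat, norm_div, norm_mul, Complex.norm_real, Complex.norm_real,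
    Real.norm_of_nonneg (Real.sqrt_nonneg _), Real.norm_of_nonneg (Real.sqrt_nonneg _),
    div_pow, mul_pow, Real.sq_sqrt (hρ _), Real.sq_sqrt (Nat.cast_nonneg m)]

lemma integral_weighted_norm_sq {D I : Type*} [MeasurableSpace D] {μ : Measure D} {ρ : D → ℝ}
    {φ : I → D → ℂ} {i : I} {r : ℝ}
    (h : (∫ s, (starRingEnd ℂ) (φ i s) * φ i s * (ρ s : ℂ) ∂μ) = r) :
    ∫ s, ρ s * ‖φ i s‖ ^ 2 ∂μ = r := by
  rw [← Complex.ofReal_inj, ← h, ← integral_complex_ofReal]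
  congr 1 with s
  rw [Complex.conj_mul']
  push_cast
  ring

/-- Lemma 6.4: if `m ≥ 2·(max_{i∈I_K∖Δ} u_i²/w_i²)·log(2N/ε)·(δ⁻² + δ⁻¹/3)` then with
probability at least `1 − ε`, `max_{i∈I_K∖Δ} ‖A e_i‖/w_i ≤ √(1+δ)`. -/
theorem stmt17 {D : Type*} [MeasurableSpace D] {I : Type*} [DecidableEq I] [Countable I]
    (μ : Measure D) [IsProbabilityMeasure μ]
    (ρ : D → ℝ) (hρ : ∀ s, 0 ≤ ρ s) (hρm : Measurable ρ)
    (φ : I → D → ℂ) (hφm : ∀ i, Measurable (φ i))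
    (horth : ∀ i j : I,
      (∫ s, (starRingEnd ℂ) (φ i s) * φ j s * (ρ s : ℂ) ∂μ) = if i = j then 1 else 0)
    (u : I → ℝ) (hu1 : ∀ i, 1 ≤ u i)
    (hu : ∀ i s, Real.sqrt (ρ s) * ‖φ i s‖ ≤ u i)
    (w : I → ℝ) (hw : ∀ i, 0 < w i)
    (IK Δ : Finset I) (hΔK : Δ ⊆ IK) (hΔne : Δ ≠ IK)
    (hw1 : ∀ i ∈ IK, i ∉ Δ → 1 ≤ w i)
    (ε δ : ℝ) (hε0 : 0 < ε) (hε1 : ε < 1) (hδ : 0 < δ)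
    (m : ℕ)
    (hm : 2 * ((IK \ Δ).sup'
            (Finset.sdiff_nonempty.mpr fun h => hΔne (Finset.Subset.antisymm hΔK h))
            fun i => u i ^ 2 / w i ^ 2) *
          Real.log (2 * IK.card / ε) * (1 / δ ^ 2 + 1 / (3 * δ)) ≤ m) :
    1 - ENNReal.ofReal ε ≤
      (Measure.pi fun _ : Fin m => μ) {t : Fin m → D |
        ∀ i ∈ IK \ Δ, l2m (fun k => Amat ρ φ t k i) ≤ Real.sqrt (1 + δ) * w i} := by
  set M := (IK \ Δ).sup'
    (Finset.sdiff_nonempty.mpr fun h => hΔne (Finset.Subset.antisymm hΔK h))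
    fun i => u i ^ 2 / w i ^ 2
  set P := Measure.pi fun _ : Fin m => μ
  obtain ⟨i₀, hi₀⟩ : (IK \ Δ).Nonempty :=
    Finset.sdiff_nonempty.mpr fun h => hΔne (Finset.Subset.antisymm hΔK h)
  have hN : (1 : ℝ) ≤ IK.card := by
    exact_mod_cast Finset.card_pos.mpr ⟨i₀, (Finset.mem_sdiff.mp hi₀).1⟩
  set L := Real.log (2 * IK.card / ε) with hL
  have hLpos : 0 < L := Real.log_pos (by rw [lt_div_iff₀ hε0]; linarith)
  have hle : ∀ i ∈ IK \ Δ, u i ^ 2 / w i ^ 2 ≤ M := fun i hi =>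
    Finset.le_sup' (fun i => u i ^ 2 / w i ^ 2) hi
  have hapos : ∀ i, 0 < u i ^ 2 / w i ^ 2 := fun i => by
    have := hw i
    have := zero_lt_one.trans_le (hu1 i)
    positivity
  have hMpos : 0 < M := (hapos i₀).trans_le (hle i₀ hi₀)
  have hmpos : (0 : ℝ) < m := lt_of_lt_of_le (by positivity) hm
  have htail : ∀ i ∈ IK \ Δ,
      P {t | Real.sqrt (1 + δ) * w i < l2m (fun k => Amat ρ φ t k i)} ≤
        ENNReal.ofReal (ε / (2 * IK.card)) := by
    intro i hi
    have hwi := hw i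
    have hw1i : 1 ≤ w i := hw1 i (Finset.mem_sdiff.mp hi).1 (Finset.mem_sdiff.mp hi).2
    have hφi := hφm i
    have hmean : ∫ s, ρ s * ‖φ i s‖ ^ 2 / w i ^ 2 ∂μ ≤ 1 := by
      rw [integral_div, integral_weighted_norm_sq (r := 1) (by simpa using horth i i)]
      exact (div_le_one (by positivity)).mpr (one_le_pow₀ hw1i)
    have hbound : ∀ s, ρ s * ‖φ i s‖ ^ 2 / w i ^ 2 ≤ u i ^ 2 / w i ^ 2 := fun s => by
      gcongr
      calc ρ s * ‖φ i s‖ ^ 2 = (Real.sqrt (ρ s) * ‖φ i s‖) ^ 2 := by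
            rw [mul_pow, Real.sq_sqrt (hρ s)]
        _ ≤ u i ^ 2 := by gcongr; exact hu i s
    have hb := measureReal_sum_ge_le_exp μ (Y := fun s => ρ s * ‖φ i s‖ ^ 2 / w i ^ 2)
      (by fun_prop) (hapos i) hδ.le
      (fun s => div_nonneg (mul_nonneg (hρ s) (sq_nonneg _)) (sq_nonneg _)) hbound hmean m
    have hexp : L ≤ m / (u i ^ 2 / w i ^ 2) * (3 * δ ^ 2 / (2 * (3 + δ))) := by
      have hκ : 1 / δ ^ 2 + 1 / (3 * δ) = (3 + δ) / (3 * δ ^ 2) := by field_simp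
      have hmi : 2 * (u i ^ 2 / w i ^ 2) * L * ((3 + δ) / (3 * δ ^ 2)) ≤ m := by
        rw [← hκ]
        refine le_trans ?_ hm
        have := hle i hi
        gcongr
      have hai := hapos i
      set a := u i ^ 2 / w i ^ 2
      calc L = 2 * a * L * ((3 + δ) / (3 * δ ^ 2)) / a * (3 * δ ^ 2 / (2 * (3 + δ))) := by
            field_simp
        _ ≤ _ := by gcongr
    have hexpL : Real.exp (-L) = ε / (2 * IK.card) := by
      rw [Real.exp_neg, hL, Real.exp_log (by positivity), inv_div]
    have hsub : {t | Real.sqrt (1 + δ) * w i < l2m (fun k => Amat ρ φ t k i)} ⊆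
        {t : Fin m → D | (1 + δ) * m ≤ ∑ k, ρ (t k) * ‖φ i (t k)‖ ^ 2 / w i ^ 2} := by
      intro t ht
      rw [Set.mem_ofPred_eq, l2m, sum_norm_Amat_sq hρ, Real.lt_sqrt (by positivity), mul_pow,
        Real.sq_sqrt (by positivity), lt_div_iff₀ hmpos] at ht
      rw [Set.mem_ofPred_eq, ← Finset.sum_div, le_div_iff₀ (by positivity)]
      linarith
    calc P {t | Real.sqrt (1 + δ) * w i < l2m (fun k => Amat ρ φ t k i)} ≤ _ :=
          measure_mono hsub
      _ = _ := (ofReal_measureReal).symm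
      _ ≤ _ := ENNReal.ofReal_le_ofReal <| hb.trans <| by
          rw [← hexpL]
          exact Real.exp_le_exp.mpr (neg_le_neg hexp)
  set S := {t : Fin m → D |
    ∀ i ∈ IK \ Δ, l2m (fun k => Amat ρ φ t k i) ≤ Real.sqrt (1 + δ) * w i}
  have hcompl : P Sᶜ ≤ ENNReal.ofReal ε := by
    have hSc : Sᶜ ⊆ ⋃ i ∈ IK \ Δ,
        {t | Real.sqrt (1 + δ) * w i < l2m (fun k => Amat ρ φ t k i)} := by
      intro t ht
      simpa [S, and_assoc] using ht
    calc P Sᶜ ≤ ∑ i ∈ IK \ Δ,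
          P {t | Real.sqrt (1 + δ) * w i < l2m (fun k => Amat ρ φ t k i)} :=
          (measure_mono hSc).trans (measure_biUnion_finset_le _ _)
      _ ≤ ∑ _i ∈ IK, ENNReal.ofReal (ε / (2 * IK.card)) :=
          (Finset.sum_le_sum htail).trans
            (Finset.sum_le_sum_of_subset Finset.sdiff_subset)
      _ = ENNReal.ofReal (IK.card * (ε / (2 * IK.card))) := by
          rw [Finset.sum_const, nsmul_eq_mul, ENNReal.ofReal_mul (by positivity),
            ENNReal.ofReal_natCast]
      _ ≤ ENNReal.ofReal ε := by
          refine ENNReal.ofReal_le_ofReal ?_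
          rw [show IK.card * (ε / (2 * IK.card)) = ε / 2 by field_simp]
          linarith
  rw [tsub_le_iff_right]
  calc 1 = P (S ∪ Sᶜ) := by rw [Set.union_compl_self, measure_univ]
    _ ≤ P S + P Sᶜ := measure_union_le _ _
    _ ≤ P S + ENNReal.ofReal ε := by gcongr
end

section
/- Let 0 < ε < 1, δ > 0, z ∈ ℓ²(I), w = (w_i)_{i∈I} positive weights, I_K ⊆ I finite with N := |I_K|, and Δ ⊆ I_K with Δ ≠ I_K. Suppose m ≥ 2·( (max_{i∈I_K∖Δ} u_i²/w_i²)·δ^{-2} + √(|Δ|_u)·(max_{i∈I_K∖Δ} u_i/w_i)·δ^{-1}/3 )·log(2N/ε). Then, with probability at least 1 − ε over the i.i.d. draw of t_1,…,t_m from μ, the random matrix A = U/√m satisfies ‖P_K P_Δ^⊥ W^{-1} A* A P_Δ z‖_∞ ≤ δ·‖z‖, i.e., max_{i∈I_K∖Δ} |(A* A P_Δ z)_i| / w_i ≤ δ·‖z‖. -/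
open scoped BigOperators
open MeasureTheory

section Bernstein

variable {E : Type*} [NormedAddCommGroup E] [InnerProductSpace ℝ E]

lemma cosh_le_of_sq_eq_convex_comb {p q r s t : ℝ} (hs : 0 ≤ s) (ht : 0 ≤ t) (hst : s + t = 1)
    (h : r ^ 2 = s * p ^ 2 + t * q ^ 2) :
    Real.cosh r ≤ s * Real.cosh p + t * Real.cosh q := by
  refine hasSum_le (fun n => ?_) (Real.hasSum_cosh r)
    (((Real.hasSum_cosh p).mul_left s).add ((Real.hasSum_cosh q).mul_left t))
  have hc := (convexOn_pow (𝕜 := ℝ) n).2 (Set.mem_Ici.mpr (sq_nonneg p))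
    (Set.mem_Ici.mpr (sq_nonneg q)) hs ht hst
  simp only [smul_eq_mul] at hc
  rw [← h] at hc
  simp only [← pow_mul] at hc
  rw [← mul_div_assoc, ← mul_div_assoc, ← add_div]
  gcongr

/-- A scalar form of the Golden–Thompson inequality, for Hermitian dilations of vectors. -/
lemma cosh_norm_add_le_s18 (a b : E) :
    Real.cosh ‖a + b‖ ≤ Real.cosh ‖a‖ * Real.cosh ‖b‖ +
      inner ℝ a b / (‖a‖ * ‖b‖) * (Real.sinh ‖a‖ * Real.sinh ‖b‖) := by
  set c := inner ℝ a b / (‖a‖ * ‖b‖) with hc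
  have hc1 := abs_le.mp (abs_real_inner_div_norm_mul_norm_le_one a b)
  have hinner : inner ℝ a b = c * (‖a‖ * ‖b‖) := by
    rcases eq_or_ne a 0 with rfl | ha
    · simp
    rcases eq_or_ne b 0 with rfl | hb
    · simp
    rw [hc]
    field_simp
  have key := cosh_le_of_sq_eq_convex_comb (p := ‖a‖ + ‖b‖) (q := ‖a‖ - ‖b‖) (r := ‖a + b‖)
    (s := (1 + c) / 2) (t := (1 - c) / 2) (by linarith [hc1.1]) (by linarith [hc1.2]) (by ring)
    (by rw [norm_add_sq_real, hinner]; ring)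
  rw [Real.cosh_add, Real.cosh_sub] at key
  linarith

lemma cosh_norm_add_le_exp (a b : E) :
    Real.cosh ‖a + b‖ ≤ Real.cosh ‖a‖ * (Real.exp ‖b‖ - ‖b‖) +
      Real.sinh ‖a‖ / ‖a‖ * inner ℝ a b := by
  have h := cosh_norm_add_le_s18 a b
  set c := inner ℝ a b / (‖a‖ * ‖b‖) with hc
  have hc1 : c ≤ 1 := (abs_le.mp (abs_real_inner_div_norm_mul_norm_le_one a b)).2
  have hinner : Real.sinh ‖a‖ / ‖a‖ * inner ℝ a b = c * (Real.sinh ‖a‖ * ‖b‖) := by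
    rcases eq_or_ne a 0 with rfl | ha
    · simp
    rcases eq_or_ne b 0 with rfl | hb
    · simp
    rw [hc]
    field_simp
  have hs : ‖b‖ ≤ Real.sinh ‖b‖ := Real.self_le_sinh_iff.mpr (norm_nonneg b)
  have ha : 0 ≤ Real.sinh ‖a‖ := Real.sinh_nonneg_iff.mpr (norm_nonneg a)
  have hsc : Real.sinh ‖a‖ ≤ Real.cosh ‖a‖ := (Real.sinh_lt_cosh _).le
  rw [hinner, ← Real.cosh_add_sinh ‖b‖]
  have h1 : c * (Real.sinh ‖a‖ * (Real.sinh ‖b‖ - ‖b‖)) ≤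
      1 * (Real.cosh ‖a‖ * (Real.sinh ‖b‖ - ‖b‖)) := by
    have h0 : 0 ≤ Real.sinh ‖b‖ - ‖b‖ := sub_nonneg.mpr hs
    gcongr
  linarith

lemma exp_le_one_add_add_sq_div {x : ℝ} (hx : 0 ≤ x) (hx3 : x < 3) :
    Real.exp x ≤ 1 + x + x ^ 2 / 2 / (1 - x / 3) := by
  have hexp : HasSum (fun n : ℕ => x ^ n / n.factorial) (Real.exp x) := by
    rw [Real.exp_eq_exp_ℝ]
    exact NormedSpace.expSeries_div_hasSum_exp x
  have htail := (hasSum_nat_add_iff' 2).mpr hexp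
  have hgeo := (hasSum_geometric_of_lt_one (r := x / 3) (by positivity) (by linarith)).mul_left
    (x ^ 2 / 2)
  have hle := hasSum_le (fun n => ?_) htail hgeo
  · simp only [Finset.sum_range_succ, Finset.sum_range_zero, pow_zero, pow_one,
      Nat.factorial_zero, Nat.factorial_one, Nat.cast_one, div_one, zero_add] at hle
    rw [div_eq_mul_inv _ (1 - x / 3)]
    linarith
  · have hf : (2 * 3 ^ n : ℝ) ≤ ((n + 2).factorial : ℝ) := by
      have := Nat.factorial_mul_pow_le_factorial (m := 2) (n := n)
      rw [add_comm n 2]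
      exact_mod_cast this
    calc x ^ (n + 2) / ((n + 2).factorial : ℝ) ≤ x ^ (n + 2) / (2 * 3 ^ n) := by gcongr
      _ = x ^ 2 / 2 * (x / 3) ^ n := by rw [div_pow]; field_simp; ring

variable {D : Type*} [MeasurableSpace D] {μ : Measure D} [IsProbabilityMeasure μ]

lemma integrable_comp_of_norm_le {F : Type*} [NormedAddCommGroup F] {Ω : Type*}
    [MeasurableSpace Ω] {P : Measure Ω} [IsFiniteMeasure P]
    {X : Ω → F} (hX : StronglyMeasurable X) {R : ℝ} (hR : ∀ s, ‖X s‖ ≤ R)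
    {f : ℝ → ℝ} (hf : Continuous f) : Integrable (fun s => f ‖X s‖) P := by
  obtain ⟨C, hC⟩ := isCompact_Icc.exists_bound_of_continuousOn (s := Set.Icc 0 R) hf.continuousOn
  exact Integrable.of_bound (hf.comp_stronglyMeasurable hX.norm).aestronglyMeasurable C
    (Filter.Eventually.of_forall fun s => hC _ ⟨norm_nonneg _, hR s⟩)

lemma integral_cosh_norm_add_le [CompleteSpace E] {Y : D → E} (hY : StronglyMeasurable Y) {M : ℝ}
    (hM : ∀ s, ‖Y s‖ ≤ M) (hmean : ∫ s, Y s ∂μ = 0) (a : E) :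
    ∫ s, Real.cosh ‖a + Y s‖ ∂μ ≤
      Real.cosh ‖a‖ * ∫ s, (Real.exp ‖Y s‖ - ‖Y s‖) ∂μ := by
  have hYi : Integrable Y μ :=
    Integrable.of_bound hY.aestronglyMeasurable M (Filter.Eventually.of_forall hM)
  have h1 : Integrable (fun s => Real.exp ‖Y s‖ - ‖Y s‖) μ :=
    integrable_comp_of_norm_le hY hM (f := fun x => Real.exp x - x) (by fun_prop)
  have h2 : Integrable (fun s => inner ℝ a (Y s)) μ := hYi.const_inner a
  have h3 : Integrable (fun s => Real.cosh ‖a + Y s‖) μ :=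
    integrable_comp_of_norm_le (stronglyMeasurable_const.add hY) (R := ‖a‖ + M)
      (fun s => (norm_add_le _ _).trans (by have := hM s; gcongr)) Real.continuous_cosh
  calc ∫ s, Real.cosh ‖a + Y s‖ ∂μ
      ≤ ∫ s, (Real.cosh ‖a‖ * (Real.exp ‖Y s‖ - ‖Y s‖) +
          Real.sinh ‖a‖ / ‖a‖ * inner ℝ a (Y s)) ∂μ :=
        integral_mono h3 ((h1.const_mul _).add (h2.const_mul _))
          fun s => cosh_norm_add_le_exp a (Y s)
    _ = _ := by
        rw [integral_add (h1.const_mul _) (h2.const_mul _), integral_const_mul,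
          integral_const_mul, integral_inner hYi, hmean, inner_zero_right, mul_zero, add_zero]

lemma integral_cosh_norm_add_sum_le [CompleteSpace E] {Y : D → E} (hY : StronglyMeasurable Y)
    {M : ℝ} (hM : ∀ s, ‖Y s‖ ≤ M) (hmean : ∫ s, Y s ∂μ = 0) (m : ℕ) (a : E) :
    ∫ t, Real.cosh ‖a + ∑ k, Y (t k)‖ ∂(Measure.pi fun _ : Fin m => μ) ≤
      Real.cosh ‖a‖ * (∫ s, (Real.exp ‖Y s‖ - ‖Y s‖) ∂μ) ^ m := by
  set K := ∫ s, (Real.exp ‖Y s‖ - ‖Y s‖) ∂μ with hK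
  have hK0 : 0 ≤ K := integral_nonneg fun s => by
    have := Real.add_one_le_exp ‖Y s‖
    simp only [Pi.zero_apply]
    linarith
  induction m generalizing a with
  | zero => simp
  | succ m ih =>
    have hmp := measurePreserving_piFinSuccAbove (fun _ : Fin (m + 1) => μ) 0
    have hS : StronglyMeasurable fun p : D × (Fin m → D) => a + Y p.1 + ∑ k, Y (p.2 k) :=
      (stronglyMeasurable_const.add (hY.comp_measurable measurable_fst)).add
        (Finset.stronglyMeasurable_fun_sum _ fun k _ =>
          hY.comp_measurable ((measurable_pi_apply k).comp measurable_snd))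
    have hR : ∀ p : D × (Fin m → D), ‖a + Y p.1 + ∑ k, Y (p.2 k)‖ ≤ ‖a‖ + M + ∑ _k : Fin m, M :=
      fun p => (norm_add_le _ _).trans (add_le_add
        ((norm_add_le _ _).trans (add_le_add le_rfl (hM _)))
        (norm_sum_le_of_le _ fun k _ => hM _))
    have hint := integrable_comp_of_norm_le (P := μ.prod (Measure.pi fun _ : Fin m => μ)) hS hR
      Real.continuous_cosh
    have hone : Integrable (fun s => Real.cosh ‖a + Y s‖) μ :=
      integrable_comp_of_norm_le (stronglyMeasurable_const.add hY) (R := ‖a‖ + M)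
        (fun s => (norm_add_le _ _).trans (add_le_add le_rfl (hM s))) Real.continuous_cosh
    calc ∫ t, Real.cosh ‖a + ∑ k, Y (t k)‖ ∂(Measure.pi fun _ : Fin (m + 1) => μ)
        = ∫ p : D × (Fin m → D), Real.cosh ‖a + Y p.1 + ∑ k, Y (p.2 k)‖
            ∂(μ.prod (Measure.pi fun _ : Fin m => μ)) := by
          rw [← hmp.integral_comp']
          refine integral_congr_ae (Filter.Eventually.of_forall fun t => ?_)
          simp [Fin.sum_univ_succ, add_assoc, MeasurableEquiv.piFinSuccAbove,
            Fin.insertNthEquiv, Fin.tail]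
      _ = ∫ s, ∫ t : Fin m → D, Real.cosh ‖a + Y s + ∑ k, Y (t k)‖
            ∂(Measure.pi fun _ : Fin m => μ) ∂μ := integral_prod _ hint
      _ ≤ ∫ s, Real.cosh ‖a + Y s‖ * K ^ m ∂μ :=
          integral_mono hint.integral_prod_left (hone.mul_const _) fun s => ih (a + Y s)
      _ = (∫ s, Real.cosh ‖a + Y s‖ ∂μ) * K ^ m := integral_mul_const _ _
      _ ≤ Real.cosh ‖a‖ * K * K ^ m := by
          gcongr
          exact integral_cosh_norm_add_le hY hM hmean a
      _ = Real.cosh ‖a‖ * K ^ (m + 1) := by ring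

/-- Bernstein's moment bound. -/
lemma integral_exp_norm_sub_norm_le {F : Type*} [NormedAddCommGroup F] {Y : D → F}
    (hY : StronglyMeasurable Y)
    {M V : ℝ} (hM : ∀ s, ‖Y s‖ ≤ M) (hM3 : M < 3) (hV : ∫ s, ‖Y s‖ ^ 2 ∂μ ≤ V) :
    ∫ s, (Real.exp ‖Y s‖ - ‖Y s‖) ∂μ ≤ Real.exp (V / 2 / (1 - M / 3)) := by
  have hM3' : 0 < 1 - M / 3 := by linarith
  have h2 : Integrable (fun s => ‖Y s‖ ^ 2) μ :=
    integrable_comp_of_norm_le hY hM (f := fun x => x ^ 2) (by fun_prop)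
  calc ∫ s, (Real.exp ‖Y s‖ - ‖Y s‖) ∂μ
      ≤ ∫ s, (1 + ‖Y s‖ ^ 2 * (1 / 2 / (1 - M / 3))) ∂μ := by
        refine integral_mono
          (integrable_comp_of_norm_le hY hM (f := fun x => Real.exp x - x) (by fun_prop))
          ((integrable_const _).add (h2.mul_const _)) fun s => ?_
        have h := exp_le_one_add_add_sq_div (norm_nonneg (Y s)) ((hM s).trans_lt hM3)
        have h' : ‖Y s‖ ^ 2 / 2 / (1 - ‖Y s‖ / 3) ≤ ‖Y s‖ ^ 2 / 2 / (1 - M / 3) := by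
          have := hM s
          gcongr
        have h'' : ‖Y s‖ ^ 2 / 2 / (1 - M / 3) = ‖Y s‖ ^ 2 * (1 / 2 / (1 - M / 3)) := by ring
        dsimp only
        linarith
    _ = 1 + (∫ s, ‖Y s‖ ^ 2 ∂μ) * (1 / 2 / (1 - M / 3)) := by
        rw [integral_add (integrable_const _) (h2.mul_const _), integral_mul_const]
        simp
    _ ≤ 1 + V * (1 / 2 / (1 - M / 3)) := by gcongr
    _ = V / 2 / (1 - M / 3) + 1 := by ring
    _ ≤ _ := Real.add_one_le_exp _

/-- Bernstein's inequality for sums of i.i.d. bounded centred vectors of a Hilbert space. -/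
theorem measureReal_le_norm_sum_le [CompleteSpace E] {Y : D → E} (hY : StronglyMeasurable Y)
    {M V τ : ℝ} (hM : ∀ s, ‖Y s‖ ≤ M) (hM0 : 0 ≤ M) (hmean : ∫ s, Y s ∂μ = 0)
    (hV : ∫ s, ‖Y s‖ ^ 2 ∂μ ≤ V) (hV0 : 0 < V) (hτ : 0 < τ) (m : ℕ) :
    (Measure.pi fun _ : Fin m => μ).real {t | m * τ ≤ ‖∑ k, Y (t k)‖} ≤
      2 * Real.exp (-(m * τ ^ 2 / (2 * (V + M * τ / 3)))) := by
  set P := Measure.pi fun _ : Fin m => μ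
  have hB : 0 < V + M * τ / 3 := by positivity
  obtain ⟨l, hl⟩ : ∃ l, l = τ / (V + M * τ / 3) := ⟨_, rfl⟩
  have hl0 : 0 < l := hl ▸ by positivity
  have hlM : 1 - l * M / 3 = V / (V + M * τ / 3) := by
    rw [hl]
    field_simp
    ring
  have hlM3 : l * M < 3 := by
    have : 0 < V / (V + M * τ / 3) := by positivity
    linarith
  have hX : StronglyMeasurable fun s => l • Y s := hY.const_smul l
  have hXM : ∀ s, ‖l • Y s‖ ≤ l * M := fun s => by
    rw [norm_smul, Real.norm_of_nonneg hl0.le]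
    have := hM s
    gcongr
  have hXV : ∫ s, ‖l • Y s‖ ^ 2 ∂μ ≤ l ^ 2 * V := by
    simp only [norm_smul, Real.norm_of_nonneg hl0.le, mul_pow]
    rw [integral_const_mul]
    gcongr
  have hmom := integral_cosh_norm_add_sum_le (μ := μ) hX hXM
    (by rw [integral_smul, hmean, smul_zero]) m 0
  have hK := integral_exp_norm_sub_norm_le (μ := μ) hX hXM hlM3 hXV
  have hK0 : 0 ≤ ∫ s, (Real.exp ‖l • Y s‖ - ‖l • Y s‖) ∂μ := integral_nonneg fun s => by
    have := Real.add_one_le_exp ‖l • Y s‖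
    simp only [Pi.zero_apply]
    linarith
  simp only [norm_zero, Real.cosh_zero, one_mul, zero_add, ← Finset.smul_sum] at hmom
  have hint : Integrable (fun t : Fin m → D => Real.cosh ‖l • ∑ k, Y (t k)‖) P :=
    integrable_comp_of_norm_le (R := l * ∑ _k : Fin m, M)
      ((Finset.stronglyMeasurable_fun_sum _ fun k _ =>
        hY.comp_measurable (measurable_pi_apply k)).const_smul l)
      (fun t => by
        change ‖l • ∑ k, Y (t k)‖ ≤ _
        rw [norm_smul, Real.norm_of_nonneg hl0.le]
        have := norm_sum_le_of_le Finset.univ fun (k : Fin m) _ => hM (t k)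
        gcongr) Real.continuous_cosh
  have hmarkov := mul_meas_ge_le_integral_of_nonneg
    (Filter.Eventually.of_forall fun t => (Real.cosh_pos _).le) hint (Real.cosh (l * (m * τ)))
  have hsub : {t : Fin m → D | m * τ ≤ ‖∑ k, Y (t k)‖} ⊆
      {t | Real.cosh (l * (m * τ)) ≤ Real.cosh ‖l • ∑ k, Y (t k)‖} := fun t ht => by
    simp only [Set.mem_ofPred_eq] at ht ⊢
    rw [Real.cosh_le_cosh, abs_of_nonneg (by positivity), abs_norm, norm_smul,
      Real.norm_of_nonneg hl0.le]
    gcongr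
  have hcosh : Real.exp (l * (m * τ)) / 2 ≤ Real.cosh (l * (m * τ)) := by
    rw [Real.cosh_eq]
    have := Real.exp_pos (-(l * (m * τ)))
    linarith
  have hmain : Real.exp (l * (m * τ)) / 2 * P.real {t | m * τ ≤ ‖∑ k, Y (t k)‖} ≤
      Real.exp (m * (l ^ 2 * V / 2 / (1 - l * M / 3))) :=
    calc _ ≤ Real.cosh (l * (m * τ)) *
          P.real {t | Real.cosh (l * (m * τ)) ≤ Real.cosh ‖l • ∑ k, Y (t k)‖} := by
          gcongr
          exact measure_ne_top P _
      _ ≤ _ := hmarkov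
      _ ≤ _ := hmom
      _ ≤ Real.exp (l ^ 2 * V / 2 / (1 - l * M / 3)) ^ m := by gcongr
      _ = _ := (Real.exp_nat_mul _ m).symm
  have hexp : m * (l ^ 2 * V / 2 / (1 - l * M / 3)) =
      l * (m * τ) + -(m * τ ^ 2 / (2 * (V + M * τ / 3))) := by
    rw [hlM, hl]
    field_simp
    ring
  rw [hexp, Real.exp_add] at hmain
  have hpos := Real.exp_pos (l * (m * τ))
  refine le_of_mul_le_mul_left ?_ hpos
  linarith

end Bernstein

section Sampling

variable {D : Type*} {I : Type*} {ρ : D → ℝ} {φ : I → D → ℂ}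

lemma AstarA_proj [DecidableEq I] (hρ : ∀ s, 0 ≤ ρ s) {m : ℕ} (t : Fin m → D) (Δ : Finset I)
    (z : I → ℂ) (i : I) :
    AstarA ρ φ t (proj Δ z) i =
      (∑ k, ∑ j ∈ Δ, z j * ((starRingEnd ℂ) (φ i (t k)) * φ j (t k) * (ρ (t k) : ℂ))) / m := by
  rw [AstarA, Finset.sum_div]
  refine Finset.sum_congr rfl fun k _ => ?_
  have hA : Aapp ρ φ t (proj Δ z) k = ∑ j ∈ Δ, z j * Amat ρ φ t k j := by
    rw [Aapp, tsum_eq_sum (s := Δ) fun j hj => by simp [proj, hj]]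
    exact Finset.sum_congr rfl fun j hj => by simp [proj, hj]
  rw [hA, Finset.mul_sum, Finset.sum_div]
  refine Finset.sum_congr rfl fun j _ => ?_
  have hs : (ρ (t k) : ℂ) = (Real.sqrt (ρ (t k)) : ℂ) * Real.sqrt (ρ (t k)) := by
    rw [← Complex.ofReal_mul, Real.mul_self_sqrt (hρ _)]
  have hm : (m : ℂ) = (Real.sqrt m : ℂ) * Real.sqrt m := by
    rw [← Complex.ofReal_mul, Real.mul_self_sqrt (Nat.cast_nonneg _), Complex.ofReal_natCast]
  simp only [Amat, Umat, map_div₀, map_mul, Complex.conj_ofReal]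
  rw [hs, hm, mul_comm (Real.sqrt (m : ℝ) : ℂ), ← div_div]
  ring

lemma norm_conj_mul_mul_le (hρ : ∀ s, 0 ≤ ρ s) {u : I → ℝ}
    (hu : ∀ i s, Real.sqrt (ρ s) * ‖φ i s‖ ≤ u i) (i j : I) (s : D) :
    ‖(starRingEnd ℂ) (φ i s) * φ j s * (ρ s : ℂ)‖ ≤ u i * u j := by
  rw [norm_mul, norm_mul, RCLike.norm_conj, Complex.norm_real, Real.norm_of_nonneg (hρ s)]
  calc ‖φ i s‖ * ‖φ j s‖ * ρ s = Real.sqrt (ρ s) * ‖φ i s‖ * (Real.sqrt (ρ s) * ‖φ j s‖) := by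
        nth_rw 1 [← Real.mul_self_sqrt (hρ s)]
        ring
    _ ≤ u i * u j := by
        have := hu i s
        have := hu j s
        have : 0 ≤ u i := le_trans (by positivity) (hu i s)
        gcongr

variable [MeasurableSpace D] {μ : Measure D}

lemma integrable_conj_mul_mul [IsFiniteMeasure μ] (hρ : ∀ s, 0 ≤ ρ s) (hρm : Measurable ρ)
    (hφm : ∀ i, Measurable (φ i)) {u : I → ℝ}
    (hu : ∀ i s, Real.sqrt (ρ s) * ‖φ i s‖ ≤ u i) (i j : I) :
    Integrable (fun s => (starRingEnd ℂ) (φ i s) * φ j s * (ρ s : ℂ)) μ := by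
  refine Integrable.of_bound (Measurable.aestronglyMeasurable ?_) (u i * u j)
    (Filter.Eventually.of_forall (norm_conj_mul_mul_le hρ hu i j))
  have := hφm i
  have := hφm j
  fun_prop

lemma integral_norm_sq_sum_mul [DecidableEq I]
    (hint : ∀ i j, Integrable (fun s => (starRingEnd ℂ) (φ i s) * φ j s * (ρ s : ℂ)) μ)
    (horth : ∀ i j : I,
      (∫ s, (starRingEnd ℂ) (φ i s) * φ j s * (ρ s : ℂ) ∂μ) = if i = j then 1 else 0)
    (Δ : Finset I) (z : I → ℂ) :
    ∫ s, ρ s * ‖∑ j ∈ Δ, z j * φ j s‖ ^ 2 ∂μ = ∑ j ∈ Δ, ‖z j‖ ^ 2 := by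
  have hexpand : ∀ s, ((ρ s * ‖∑ j ∈ Δ, z j * φ j s‖ ^ 2 : ℝ) : ℂ) =
      ∑ i ∈ Δ, ∑ j ∈ Δ, (starRingEnd ℂ) (z i) * z j *
        ((starRingEnd ℂ) (φ i s) * φ j s * (ρ s : ℂ)) := fun s => by
    rw [Complex.ofReal_mul, Complex.ofReal_pow, ← Complex.conj_mul', map_sum, Finset.sum_mul_sum,
      Finset.mul_sum]
    refine Finset.sum_congr rfl fun i _ => ?_
    rw [Finset.mul_sum]
    refine Finset.sum_congr rfl fun j _ => ?_
    rw [map_mul]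
    ring
  apply Complex.ofReal_injective
  rw [← integral_complex_ofReal]
  simp_rw [hexpand]
  rw [integral_finsetSum _ fun i _ => integrable_finsetSum _ fun j _ => (hint i j).const_mul _,
    Complex.ofReal_sum]
  refine Finset.sum_congr rfl fun i hi => ?_
  rw [integral_finsetSum _ fun j _ => (hint i j).const_mul _]
  simp only [integral_const_mul, horth, mul_ite, mul_one, mul_zero, Finset.sum_ite_eq, hi, if_true]
  rw [Complex.conj_mul', Complex.ofReal_pow]

lemma measureReal_lt_norm_AstarA_le [DecidableEq I] [IsProbabilityMeasure μ]
    (hρ : ∀ s, 0 ≤ ρ s) (hρm : Measurable ρ) (hφm : ∀ i, Measurable (φ i))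
    (horth : ∀ i j : I,
      (∫ s, (starRingEnd ℂ) (φ i s) * φ j s * (ρ s : ℂ) ∂μ) = if i = j then 1 else 0)
    {u : I → ℝ} (hu : ∀ i s, Real.sqrt (ρ s) * ‖φ i s‖ ≤ u i)
    {z : I → ℂ} (hz : Summable fun i => ‖z i‖ ^ 2) {Δ : Finset I} {i : I} (hi : i ∉ Δ)
    (hui : 0 < u i) {δ : ℝ} (hδ : 0 < δ) (m : ℕ) :
    (Measure.pi fun _ : Fin m => μ).real {t | δ * l2I z < ‖AstarA ρ φ t (proj Δ z) i‖} ≤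
      2 * Real.exp (-(m * δ ^ 2 /
        (2 * (u i ^ 2 + Real.sqrt (∑ j ∈ Δ, u j ^ 2) * u i * δ / 3)))) := by
  set L := l2I z with hL
  set S := Real.sqrt (∑ j ∈ Δ, u j ^ 2) with hS
  have hL0 : 0 ≤ L := Real.sqrt_nonneg _
  have hzL : ∑ j ∈ Δ, ‖z j‖ ^ 2 ≤ L ^ 2 := by
    rw [hL, l2I, Real.sq_sqrt (tsum_nonneg fun _ => sq_nonneg _)]
    exact hz.sum_le_tsum _ fun _ _ => sq_nonneg _
  rcases hL0.eq_or_lt with hL0' | hLpos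
  · have hz0 : ∀ j ∈ Δ, z j = 0 := fun j hj => by
      have h := (Finset.single_le_sum (f := fun j => ‖z j‖ ^ 2) (fun _ _ => sq_nonneg _) hj).trans
        hzL
      rw [← hL0'] at h
      simpa using le_antisymm (by simpa using h) (sq_nonneg ‖z j‖)
    have hA : ∀ t : Fin m → D, AstarA ρ φ t (proj Δ z) i = 0 := fun t => by
      rw [AstarA_proj hρ, Finset.sum_eq_zero, zero_div]
      exact fun k _ => Finset.sum_eq_zero fun j hj => by rw [hz0 j hj, zero_mul]
    simp only [hA, ← hL0', mul_zero, norm_zero, lt_self_iff_false, Set.ofPred_false,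
      measureReal_empty]
    positivity
  have hint := integrable_conj_mul_mul (μ := μ) hρ hρm hφm hu
  set Y : D → ℂ := fun s =>
    ∑ j ∈ Δ, z j * ((starRingEnd ℂ) (φ i s) * φ j s * (ρ s : ℂ)) with hY
  have hYm : StronglyMeasurable Y := Measurable.stronglyMeasurable (by
    have h := hφm
    fun_prop)
  have hYM : ∀ s, ‖Y s‖ ≤ u i * S * L := fun s =>
    calc ‖Y s‖ ≤ ∑ j ∈ Δ, ‖z j‖ * (u i * u j) := norm_sum_le_of_le _ fun j _ => by
          rw [norm_mul]
          have := norm_conj_mul_mul_le hρ hu i j s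
          gcongr
      _ = u i * ∑ j ∈ Δ, u j * ‖z j‖ := by
          rw [Finset.mul_sum]
          exact Finset.sum_congr rfl fun j _ => by ring
      _ ≤ u i * (S * Real.sqrt (∑ j ∈ Δ, ‖z j‖ ^ 2)) := by
          gcongr
          exact Real.sum_mul_le_sqrt_mul_sqrt _ _ _
      _ ≤ u i * (S * L) := by
          gcongr
          exact Real.sqrt_le_iff.mpr ⟨hL0, hzL⟩
      _ = u i * S * L := by ring
  have hmean : ∫ s, Y s ∂μ = 0 := by
    rw [hY, integral_finsetSum _ fun j _ => (hint i j).const_mul _]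
    refine Finset.sum_eq_zero fun j hj => ?_
    rw [integral_const_mul, horth, if_neg (ne_of_mem_of_not_mem hj hi).symm, mul_zero]
  have hYsq : ∀ s, ‖Y s‖ ^ 2 ≤ u i ^ 2 * (ρ s * ‖∑ j ∈ Δ, z j * φ j s‖ ^ 2) := fun s => by
    have hfac : Y s = (starRingEnd ℂ) (φ i s) * (ρ s : ℂ) * ∑ j ∈ Δ, z j * φ j s := by
      rw [hY, Finset.mul_sum]
      exact Finset.sum_congr rfl fun j _ => by ring
    rw [hfac, norm_mul, norm_mul, RCLike.norm_conj, Complex.norm_real,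
      Real.norm_of_nonneg (hρ s)]
    calc _ = (Real.sqrt (ρ s) ^ 2 * ‖φ i s‖ ^ 2) * (ρ s * ‖∑ j ∈ Δ, z j * φ j s‖ ^ 2) := by
          rw [Real.sq_sqrt (hρ s)]
          ring
      _ ≤ _ := by
          rw [← mul_pow]
          have := hu i s
          have := hρ s
          gcongr
  have hsqint : Integrable (fun s => ρ s * ‖∑ j ∈ Δ, z j * φ j s‖ ^ 2) μ := by
    by_cases h : ∑ j ∈ Δ, ‖z j‖ ^ 2 = 0
    · have hz0 : ∀ j ∈ Δ, z j = 0 := fun j hj => by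
        simpa using (Finset.sum_eq_zero_iff_of_nonneg fun _ _ => sq_nonneg _).mp h j hj
      have h0 : ∀ s, ∑ j ∈ Δ, z j * φ j s = 0 := fun s =>
        Finset.sum_eq_zero fun j hj => by rw [hz0 j hj, zero_mul]
      simp [h0]
    · exact not_imp_comm.mp integral_undef (by rwa [integral_norm_sq_sum_mul hint horth])
  have hYV : ∫ s, ‖Y s‖ ^ 2 ∂μ ≤ u i ^ 2 * L ^ 2 :=
    calc _ ≤ ∫ s, u i ^ 2 * (ρ s * ‖∑ j ∈ Δ, z j * φ j s‖ ^ 2) ∂μ :=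
          integral_mono (integrable_comp_of_norm_le hYm hYM (f := fun x => x ^ 2) (by fun_prop))
            (hsqint.const_mul _) hYsq
      _ ≤ _ := by
          rw [integral_const_mul, integral_norm_sq_sum_mul hint horth]
          gcongr
  have hbern := measureReal_le_norm_sum_le (μ := μ) hYm hYM (by positivity) hmean hYV
    (by positivity) (mul_pos hδ hLpos) m
  calc _ ≤ (Measure.pi fun _ : Fin m => μ).real {t | m * (δ * L) ≤ ‖∑ k, Y (t k)‖} := by
        refine measureReal_mono (fun t ht => ?_) (measure_ne_top _ _)
        have ht' : δ * L < ‖AstarA ρ φ t (proj Δ z) i‖ := ht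
        rw [AstarA_proj hρ, norm_div, Complex.norm_natCast] at ht'
        change m * (δ * L) ≤ ‖∑ k, Y (t k)‖
        rcases (Nat.cast_nonneg (α := ℝ) m).eq_or_lt with hm | hm
        · rw [← hm, zero_mul]
          exact norm_nonneg _
        · rw [lt_div_iff₀ hm] at ht'
          linarith
    _ ≤ _ := hbern
    _ = _ := by
        congr 3
        have hden : 0 < u i ^ 2 + S * u i * δ / 3 := by positivity
        field_simp

end Sampling

/-- Lemma 6.5: for fixed `z ∈ ℓ²(I)`, if
`m ≥ 2·((max_{i∈I_K∖Δ} u_i²/w_i²)·δ⁻² + √(|Δ|_u)·(max_{i∈I_K∖Δ} u_i/w_i)·δ⁻¹/3)·log(2N/ε)`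
then with probability at least `1 − ε`,
`‖P_K P_Δ^⊥ W⁻¹ A* A P_Δ z‖_∞ ≤ δ‖z‖`. -/
theorem stmt18 {D : Type*} [MeasurableSpace D] {I : Type*} [DecidableEq I] [Countable I]
    (μ : Measure D) [IsProbabilityMeasure μ]
    (ρ : D → ℝ) (hρ : ∀ s, 0 ≤ ρ s) (hρm : Measurable ρ)
    (φ : I → D → ℂ) (hφm : ∀ i, Measurable (φ i))
    (horth : ∀ i j : I,
      (∫ s, (starRingEnd ℂ) (φ i s) * φ j s * (ρ s : ℂ) ∂μ) = if i = j then 1 else 0)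
    (u : I → ℝ) (hu1 : ∀ i, 1 ≤ u i)
    (hu : ∀ i s, Real.sqrt (ρ s) * ‖φ i s‖ ≤ u i)
    (w : I → ℝ) (hw : ∀ i, 0 < w i)
    (IK Δ : Finset I) (hΔK : Δ ⊆ IK) (hΔne : Δ ≠ IK)
    (ε δ : ℝ) (hε0 : 0 < ε) (hε1 : ε < 1) (hδ : 0 < δ)
    (z : I → ℂ) (hz : Summable fun i => ‖z i‖ ^ 2)
    (m : ℕ)
    (hm : 2 * (((IK \ Δ).sup'
              (Finset.sdiff_nonempty.mpr fun h => hΔne (Finset.Subset.antisymm hΔK h))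
              fun i => u i ^ 2 / w i ^ 2) / δ ^ 2 +
            Real.sqrt (∑ i ∈ Δ, u i ^ 2) *
              ((IK \ Δ).sup'
                (Finset.sdiff_nonempty.mpr fun h => hΔne (Finset.Subset.antisymm hΔK h))
                fun i => u i / w i) / (3 * δ)) *
          Real.log (2 * IK.card / ε) ≤ m) :
    1 - ENNReal.ofReal ε ≤
      (Measure.pi fun _ : Fin m => μ) {t : Fin m → D |
        ∀ i ∈ IK \ Δ, ‖AstarA ρ φ t (proj Δ z) i‖ ≤ δ * l2I z * w i} := by
  have hne : (IK \ Δ).Nonempty :=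
    Finset.sdiff_nonempty.mpr fun h => hΔne (Finset.Subset.antisymm hΔK h)
  have hN : 1 ≤ IK.card := Finset.card_pos.mpr (hne.mono Finset.sdiff_subset)
  have hN' : (1 : ℝ) ≤ IK.card := by exact_mod_cast hN
  have hlog : 0 < Real.log (2 * IK.card / ε) :=
    Real.log_pos ((one_lt_div hε0).mpr (by linarith))
  have hbound : ∀ i ∈ IK \ Δ, (Measure.pi fun _ : Fin m => μ).real
      {t | δ * l2I z * w i < ‖AstarA ρ φ t (proj Δ z) i‖} ≤ ε / IK.card := by
    intro i hi
    have hiΔ : i ∉ Δ := (Finset.mem_sdiff.mp hi).2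
    have hui : 0 < u i := one_pos.trans_le (hu1 i)
    have hwi := hw i
    have hm' : 2 * (u i ^ 2 / w i ^ 2 / δ ^ 2 +
        Real.sqrt (∑ j ∈ Δ, u j ^ 2) * (u i / w i) / (3 * δ)) *
        Real.log (2 * IK.card / ε) ≤ m := by
      refine le_trans ?_ hm
      gcongr
      · exact Finset.le_sup' (fun i => u i ^ 2 / w i ^ 2) hi
      · exact Finset.le_sup' (fun i => u i / w i) hi
    rw [mul_right_comm δ]
    refine (measureReal_lt_norm_AstarA_le hρ hρm hφm horth hu hz hiΔ hui (mul_pos hδ hwi) m).trans ?_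
    calc _ ≤ 2 * Real.exp (-Real.log (2 * IK.card / ε)) := by
          gcongr
          rw [le_div_iff₀ (by positivity)]
          refine le_trans (le_of_eq ?_)
            (mul_le_mul_of_nonneg_right hm' (sq_nonneg (δ * w i)))
          field_simp
      _ = ε / IK.card := by
          rw [Real.exp_neg, Real.exp_log (by positivity)]
          field_simp
  rw [tsub_le_iff_right]
  set P := Measure.pi fun _ : Fin m => μ
  calc (1 : ENNReal) = P Set.univ := measure_univ.symm
    _ ≤ P ({t | ∀ i ∈ IK \ Δ, ‖AstarA ρ φ t (proj Δ z) i‖ ≤ δ * l2I z * w i} ∪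
          ⋃ i ∈ IK \ Δ, {t | δ * l2I z * w i < ‖AstarA ρ φ t (proj Δ z) i‖}) := by
        refine measure_mono fun t _ => ?_
        by_cases h : ∀ i ∈ IK \ Δ, ‖AstarA ρ φ t (proj Δ z) i‖ ≤ δ * l2I z * w i
        · exact Or.inl h
        · push Not at h
          exact Or.inr (by simpa using h)
    _ ≤ _ := measure_union_le _ _
    _ ≤ _ := by
        gcongr
        rw [← ofReal_measureReal (measure_ne_top P _)]
        refine ENNReal.ofReal_le_ofReal ((measureReal_biUnion_finset_le _ _).trans
          ((Finset.sum_le_sum hbound).trans ?_))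
        rw [Finset.sum_const, nsmul_eq_mul]
        have hcard : ((IK \ Δ).card : ℝ) ≤ IK.card := by
          exact_mod_cast Finset.card_le_card Finset.sdiff_subset
        calc _ ≤ (IK.card : ℝ) * (ε / IK.card) := by gcongr
          _ = ε := by field_simp
end
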